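/- arXiv:2110.07929 — 2 statements merged into one kernel-verified Lean document; each statement's English description precedes it below -/
import Mathlib

section
/- Fix integers n, k ≥ 1. There exists a function H from the 2×2 real matrices to ℝ such that: (i) for every invertible 2×2 real matrix A one has H(A) > 0 and f_{H(A)}(A) = 1/k, and (ii) H is real-analytic on the open set of invertible 2×2 real matrices. -/
noncomputable section

/-- The linear action of a 2×2 real matrix on the Euclidean plane. -/
def act (A : Matrix (Fin 2) (Fin 2) ℝ) (v : EuclideanSpace ℝ (Fin 2)) :
    EuclideanSpace ℝ (Fin 2) :=
  (WithLp.equiv 2 (Fin 2 → ℝ)).symm (A.mulVec (WithLp.equiv 2 (Fin 2 → ℝ) v))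

/-- The scaled standard lattice `Λ = (1/√(n(k+1))) ℤ² \ {0}`. -/
def Lam (n k : ℕ) : Set (EuclideanSpace ℝ (Fin 2)) :=
  {v | ∃ a b : ℤ, ¬(a = 0 ∧ b = 0) ∧
    v 0 = (a : ℝ) / Real.sqrt (n * (k + 1)) ∧ v 1 = (b : ℝ) / Real.sqrt (n * (k + 1))}

/-- `f_t(A) = ∑_{v ∈ A(Λ)} exp (-t ‖v‖)`. -/
def fEnt (n k : ℕ) (t : ℝ) (A : Matrix (Fin 2) (Fin 2) ℝ) : ℝ :=
  ∑' v : (act A '' Lam n k), Real.exp (-t * ‖(v : EuclideanSpace ℝ (Fin 2))‖)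

open BoundedContinuousFunction Topology

section partone
variable {ι : Type*} 

lemma coef_bound {N r d u : ℝ} (hN : 0 ≤ N) (hr : 0 ≤ r) (hu : d + r ≤ u) (m : ℕ) :
    Real.exp (-N * u) * ((N * r) ^ m / m.factorial) ≤ Real.exp (-d * N) := by
  have h1 : (N * r) ^ m / m.factorial ≤ Real.exp (N * r) :=
    Real.pow_div_factorial_le_exp _ (by positivity) m
  calc _ ≤ Real.exp (-N * u) * Real.exp (N * r) := by gcongr
    _ = Real.exp (-N * u + N * r) := (Real.exp_add _ _).symm
    _ ≤ _ := by
      apply Real.exp_le_exp.2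
      nlinarith

lemma G_analyticAt_aux {E : Type*} [NormedCommRing E] [NormedAlgebra ℝ E] [NormOneClass E]
    (ev : ι → E →L[ℝ] ℝ) (hev : ∀ i y, ‖ev i y‖ ≤ ‖y‖)
    (hevp : ∀ i y (m : ℕ), ev i (y ^ m) = (ev i y) ^ m) (N : ι → ℝ) (hN : ∀ i, 0 ≤ N i)
    (hs : ∀ e : ℝ, 0 < e → Summable fun i => Real.exp (-e * N i))
    (u : E) (d : ℝ) (hd : 0 < d) (hu : ∀ i, d ≤ ev i u) :
    AnalyticAt ℝ (fun u : E => ∑' i, Real.exp (-N i * ev i u)) u := by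
  set r : ℝ := d / 2 with hr
  have hr0 : 0 < r := by positivity
  have hS := hs r hr0
  let c : ℕ → ι → ℝ := fun m i => Real.exp (-N i * ev i u) * ((-N i) ^ m / m.factorial)
  have habs : ∀ m i, ‖c m i‖ * r ^ m = Real.exp (-N i * ev i u) * ((N i * r) ^ m / m.factorial) := by
    intro m i
    simp only [c, norm_mul, norm_div, norm_pow, norm_neg, Real.norm_eq_abs, Real.abs_exp,
      abs_of_nonneg (hN i), mul_pow, Nat.abs_cast]
    ring
  have hcb : ∀ m i, ‖c m i‖ * r ^ m ≤ Real.exp (-r * N i) := by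
    intro m i
    rw [habs]
    exact coef_bound (hN i) hr0.le (by linarith [hu i]) m
  have hcs : ∀ m, Summable fun i => ‖c m i‖ := by
    intro m
    have : Summable fun i => ‖c m i‖ * r ^ m :=
      Summable.of_nonneg_of_le (fun i => by positivity) (hcb m) hS
    exact (summable_mul_right_iff (by positivity)).1 this
  have hcn : ∀ m i, ‖c m i • ev i‖ ≤ ‖c m i‖ := by
    intro m i
    refine ContinuousLinearMap.opNorm_le_bound _ (norm_nonneg _) (fun f => ?_)
    have := hev i f
    simp only [_root_.smul_apply, smul_eq_mul, norm_mul]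
    gcongr
  have hcsn : ∀ m, Summable fun i => ‖c m i • ev i‖ := fun m =>
    Summable.of_nonneg_of_le (fun i => ContinuousLinearMap.opNorm_nonneg _) (hcn m) (hcs m)
  let L : ℕ → (E) →L[ℝ] ℝ := fun m => ∑' i, c m i • ev i
  have hL : ∀ m y, HasSum (fun i => c m i * ev i y) (L m y) := by
    intro m y
    have h := (hcsn m).of_norm.hasSum
    have h2 := h.mapL (ContinuousLinearMap.apply ℝ ℝ y)
    simpa using h2
  have hLn : ∀ m, ‖L m‖ ≤ ∑' i, ‖c m i‖ := fun m =>
    tsum_of_norm_bounded (hcs m).hasSum (hcn m)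
  let p : FormalMultilinearSeries ℝ (E) ℝ := fun m =>
    (L m).compContinuousMultilinearMap (ContinuousMultilinearMap.mkPiAlgebraFin ℝ m (E))
  have hpn : ∀ m, ‖p m‖ * r ^ m ≤ ∑' i, Real.exp (-r * N i) := by
    intro m
    have h1 : ‖p m‖ ≤ ∑' i, ‖c m i‖ := by
      refine ((L m).norm_compContinuousMultilinearMap_le _).trans ?_
      rw [ContinuousMultilinearMap.norm_mkPiAlgebraFin, mul_one]
      exact hLn m
    calc _ ≤ (∑' i, ‖c m i‖) * r ^ m := by gcongr
      _ = ∑' i, ‖c m i‖ * r ^ m := tsum_mul_right.symm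
      _ ≤ _ := Summable.tsum_le_tsum (hcb m) ((hcs m).mul_right _) hS
  have hball : HasFPowerSeriesOnBall (fun u : E => ∑' i, Real.exp (-N i * ev i u)) p u
      (ENNReal.ofReal r) := by
    refine ⟨?_, by simpa using hr0, ?_⟩
    · have := p.le_radius_of_bound (r := r.toNNReal) _ (fun m => by
        rw [Real.coe_toNNReal r hr0.le]; exact hpn m)
      exact this
    · intro y hy
      have hy' : ‖y‖ < r := by
        rw [Metric.eball_ofReal] at hy
        simpa using hy
      have hyi : ∀ i, |ev i y| ≤ r := fun i => (hev i y).trans hy'.le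
      have hexp : ∀ i (x : ℝ), HasSum (fun m : ℕ => Real.exp (-N i * ev i u) * (x ^ m / m.factorial))
          (Real.exp (-N i * ev i u) * Real.exp x) := by
        intro i x
        have := NormedSpace.expSeries_div_hasSum_exp (𝔸 := ℝ) x
        rw [← Real.exp_eq_exp_ℝ] at this
        exact this.mul_left _
      have hbig : Summable fun q : ι × ℕ =>
          Real.exp (-N q.1 * ev q.1 u) * ((N q.1 * r) ^ q.2 / q.2.factorial) := by
        refine (summable_prod_of_nonneg ?_).2 ⟨fun i => (hexp i (N i * r)).summable, ?_⟩
        · intro q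
          have := hN q.1
          simp only [Pi.zero_apply]
          positivity
        · refine Summable.of_nonneg_of_le (fun i => ?_) (fun i => ?_) hS
          · rw [(hexp i (N i * r)).tsum_eq]; positivity
          · rw [(hexp i (N i * r)).tsum_eq, ← Real.exp_add]
            apply Real.exp_le_exp.2
            nlinarith [hN i, hu i]
      have hsum : Summable fun q : ι × ℕ => c q.2 q.1 * (ev q.1 y) ^ q.2 := by
        refine Summable.of_norm_bounded hbig (fun q => ?_)
        rw [norm_mul, norm_pow, ← habs]
        gcongr
        exact hyi _
      obtain ⟨S, hS'⟩ := hsum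
      have e1 := hS'.prod_fiberwise (g := fun i => Real.exp (-N i * ev i (u + y))) (fun i => by
        have := hexp i (-N i * ev i y)
        rw [← Real.exp_add] at this
        convert! this using 1
        · funext m
          simp only [c, mul_pow]
          ring
        · simp; ring)
      have e2 := ((Equiv.prodComm ℕ ι).hasSum_iff.2 hS').prod_fiberwise
        (g := fun m => p m fun _ => y) (fun m => by
          have := hL m (y ^ m)
          simpa [p, Function.comp_def, hevp] using this)
      rw [← e1.tsum_eq] at e2
      exact e2
  exact hball.analyticAt

lemma G_analyticAt [TopologicalSpace ι] [Nonempty ι] (N : ι → ℝ) (hN : ∀ i, 0 ≤ N i)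
    (hs : ∀ e : ℝ, 0 < e → Summable fun i => Real.exp (-e * N i))
    (u : ι →ᵇ ℝ) (d : ℝ) (hd : 0 < d) (hu : ∀ i, d ≤ u i) :
    AnalyticAt ℝ (fun u : ι →ᵇ ℝ => ∑' i, Real.exp (-N i * u i)) u :=
  G_analyticAt_aux (fun i => BoundedContinuousFunction.evalCLM ℝ i)
    (fun i y => y.norm_coe_le_norm i) (fun _ _ _ => rfl) N hN hs u d hd hu

end partone

section parttwo
open scoped ContDiff

lemma sqrt_exists {E : Type*} [NormedCommRing E] [NormedAlgebra ℝ E] [CompleteSpace E]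
    (s w : E) (hw : s * w = 1) :
    ∃ g : E → E, AnalyticAt ℝ g (s * s) ∧ g (s * s) = s ∧ ∀ᶠ q in 𝓝 (s * s), g q * g q = q := by
  let f : E × E → E := fun z => z.2 * z.2 - z.1
  have hf : ContDiffAt ℝ ω f (s * s, s) := by
    have : ContDiff ℝ ω f := by fun_prop
    exact this.contDiffAt
  have hd : HasFDerivAt f ((s • ContinuousLinearMap.snd ℝ E E + s • ContinuousLinearMap.snd ℝ E E)
      - ContinuousLinearMap.fst ℝ E E) (s * s, s) := by
    have h2 : HasFDerivAt (fun z : E × E => z.2) (ContinuousLinearMap.snd ℝ E E) (s * s, s) :=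
      hasFDerivAt_snd
    have h1 : HasFDerivAt (fun z : E × E => z.1) (ContinuousLinearMap.fst ℝ E E) (s * s, s) :=
      hasFDerivAt_fst
    exact (h2.mul h2).sub h1
  have hinv : (fderiv ℝ f (s * s, s) ∘L .inr ℝ E E).IsInvertible := by
    rw [hd.fderiv]
    refine ContinuousLinearMap.IsInvertible.of_inverse
      (g := (2⁻¹ : ℝ) • ContinuousLinearMap.mul ℝ E w) ?_ ?_
    · ext v
      simp only [ContinuousLinearMap.comp_apply, ContinuousLinearMap.id_apply]
      simp
      rw [← two_smul ℝ, smul_smul, ← mul_assoc, hw]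
      norm_num
    · ext v
      simp only [ContinuousLinearMap.comp_apply, ContinuousLinearMap.id_apply]
      simp
      rw [mul_add, ← two_smul ℝ, smul_smul, ← mul_assoc, mul_comm w, hw]
      norm_num
  refine ⟨hf.implicitFunction (by simp) hinv, ?_, ?_, ?_⟩
  · exact (hf.contDiffAt_implicitFunction (by simp) hinv).analyticAt
  · exact hf.implicitFunction_apply_self (by simp) hinv
  · filter_upwards [hf.eventually_apply_implicitFunction (by simp) hinv] with q hq
    simp only [f, sub_self] at hq
    exact sub_eq_zero.1 hq

lemma quad_analyticAt {E : Type*} [NormedCommRing E] [NormedAlgebra ℝ E] [CompleteSpace E]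
    (x y : E) (z : (Fin 2 → Fin 2 → ℝ) × ℝ) :
    AnalyticAt ℝ (fun z : (Fin 2 → Fin 2 → ℝ) × ℝ =>
      (z.1 0 0 • x + z.1 0 1 • y) * (z.1 0 0 • x + z.1 0 1 • y) +
      (z.1 1 0 • x + z.1 1 1 • y) * (z.1 1 0 • x + z.1 1 1 • y)) z := by
  have : ContDiff ℝ ω (fun z : (Fin 2 → Fin 2 → ℝ) × ℝ =>
      (z.1 0 0 • x + z.1 0 1 • y) * (z.1 0 0 • x + z.1 0 1 • y) +
      (z.1 1 0 • x + z.1 1 1 • y) * (z.1 1 0 • x + z.1 1 1 • y)) := by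
    fun_prop
  exact this.contDiffAt.analyticAt

variable {ι : Type*} [TopologicalSpace ι] [DiscreteTopology ι] [Nonempty ι]

lemma sqrt_bcf (q : ι →ᵇ ℝ) (d : ℝ) (hd : 0 < d) (hq : ∀ i, d ≤ q i) :
    ∃ g : (ι →ᵇ ℝ) → (ι →ᵇ ℝ), AnalyticAt ℝ g q ∧ (∀ i, g q i = √(q i)) ∧
      ∀ᶠ p in 𝓝 q, ∀ i, g p i = √(p i) := by
  have hsd : 0 < √d := Real.sqrt_pos.2 hd
  have hsq : ∀ i, √d ≤ √(q i) := fun i => Real.sqrt_le_sqrt (hq i)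
  let s : ι →ᵇ ℝ := BoundedContinuousFunction.ofNormedAddCommGroup (fun i => √(q i))
    continuous_of_discreteTopology (√‖q‖) (fun i => by
      rw [Real.norm_of_nonneg (Real.sqrt_nonneg _)]
      exact Real.sqrt_le_sqrt ((le_abs_self _).trans (q.norm_coe_le_norm i)))
  let w : ι →ᵇ ℝ := BoundedContinuousFunction.ofNormedAddCommGroup (fun i => (√(q i))⁻¹)
    continuous_of_discreteTopology ((√d)⁻¹) (fun i => by
      rw [Real.norm_of_nonneg (by positivity)]
      exact inv_anti₀ hsd (hsq i))
  have hs : ∀ i, s i = √(q i) := fun i => rfl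
  have hw : ∀ i, w i = (√(q i))⁻¹ := fun i => rfl
  have hsw : s * w = 1 := by
    ext i
    rw [BoundedContinuousFunction.mul_apply, hs, hw]
    exact mul_inv_cancel₀ (hsd.trans_le (hsq i)).ne'
  have hss : s * s = q := by
    ext i
    rw [BoundedContinuousFunction.mul_apply, hs]
    exact Real.mul_self_sqrt (hd.le.trans (hq i))
  obtain ⟨g, hg, hgs, hge⟩ := sqrt_exists s w hsw
  rw [hss] at hg hgs hge
  refine ⟨g, hg, fun i => by rw [hgs, hs], ?_⟩
  have hnear : ∀ᶠ p in 𝓝 q, g p ∈ Metric.ball s (√d) := by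
    have hc := hg.continuousAt
    rw [ContinuousAt, hgs] at hc
    exact hc (Metric.ball_mem_nhds s hsd)
  filter_upwards [hge, hnear] with p hp hp' i
  have h1 : g p i * g p i = p i := by
    rw [← BoundedContinuousFunction.mul_apply, hp]
  have h2 : |g p i - s i| < √d := by
    rw [← Real.dist_eq]
    exact (BoundedContinuousFunction.dist_coe_le_dist i).trans_lt hp'
  have h3 : 0 ≤ g p i := by
    have := (abs_lt.1 h2).1
    have := hsq i
    rw [hs] at *
    linarith
  rw [← h1, Real.sqrt_mul_self h3]

lemma Phi_analyticAt (N : ι → ℝ) (hN : ∀ i, 0 ≤ N i)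
    (hs : ∀ e : ℝ, 0 < e → Summable fun i => Real.exp (-e * N i))
    (x y : ι →ᵇ ℝ) (A : Fin 2 → Fin 2 → ℝ) (t : ℝ) (ht : 0 < t) (d : ℝ) (hd : 0 < d)
    (hA : ∀ i, d ≤ (A 0 0 * x i + A 0 1 * y i) ^ 2 + (A 1 0 * x i + A 1 1 * y i) ^ 2) :
    AnalyticAt ℝ (fun z : (Fin 2 → Fin 2 → ℝ) × ℝ => ∑' i, Real.exp (-N i * (z.2 *
      √((z.1 0 0 * x i + z.1 0 1 * y i) ^ 2 + (z.1 1 0 * x i + z.1 1 1 * y i) ^ 2)))) (A, t) := by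
  let Q : (Fin 2 → Fin 2 → ℝ) × ℝ → (ι →ᵇ ℝ) := fun z =>
      (z.1 0 0 • x + z.1 0 1 • y) * (z.1 0 0 • x + z.1 0 1 • y) +
      (z.1 1 0 • x + z.1 1 1 • y) * (z.1 1 0 • x + z.1 1 1 • y)
  have hQ : AnalyticAt ℝ Q (A, t) := quad_analyticAt x y _
  have hQi : ∀ z i, Q z i = (z.1 0 0 * x i + z.1 0 1 * y i) ^ 2 +
      (z.1 1 0 * x i + z.1 1 1 * y i) ^ 2 := by
    intro z i
    rw [pow_two, pow_two]
    rfl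
  obtain ⟨g, hg, hgq, hge⟩ := sqrt_bcf (Q (A, t)) d hd (fun i => by rw [hQi]; exact hA i)
  have hU : AnalyticAt ℝ (fun z => z.2 • g (Q z)) (A, t) :=
    analyticAt_snd.smul (hg.comp hQ)
  have hG := G_analyticAt N hN hs (t • g (Q (A, t))) (t * √d) (by positivity) (fun i => by
    rw [BoundedContinuousFunction.smul_apply, hgq, hQi, smul_eq_mul]
    gcongr
    exact hA i)
  have hcomp := AnalyticAt.fun_comp (f := fun z : (Fin 2 → Fin 2 → ℝ) × ℝ => z.2 • g (Q z))
    (x := (A, t)) hG hU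
  refine hcomp.congr ?_
  filter_upwards [hQ.continuousAt.eventually hge] with z hz
  refine tsum_congr (fun i => ?_)
  rw [BoundedContinuousFunction.smul_apply, hz, hQi, smul_eq_mul]

end parttwo

section partthree
variable {ι : Type*}

lemma phi_summable (N S : ι → ℝ) (hN : ∀ i, 1 ≤ N i)
    (hs : ∀ e : ℝ, 0 < e → Summable fun i => Real.exp (-e * N i))
    (e : ℝ) (he : 0 < e) (hS : ∀ i, e ≤ S i) (t : ℝ) (ht : 0 < t) :
    Summable fun i => Real.exp (-N i * (t * S i)) := by
  refine Summable.of_nonneg_of_le (fun i => (Real.exp_pos _).le) (fun i => ?_)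
    (hs (t * e) (by positivity))
  apply Real.exp_le_exp.2
  have h1 : t * e ≤ t * S i := by gcongr; exact hS i
  have := mul_le_mul_of_nonneg_left h1 (zero_le_one.trans (hN i))
  linarith

lemma phi_anti (N S : ι → ℝ) (hN : ∀ i, 1 ≤ N i)
    (hs : ∀ e : ℝ, 0 < e → Summable fun i => Real.exp (-e * N i))
    (e : ℝ) (he : 0 < e) (hS : ∀ i, e ≤ S i) (j : ι) {t t' : ℝ} (ht : 0 < t) (htt : t ≤ t') :
    (∑' i, Real.exp (-N i * (t' * S i))) - Real.exp (-N j * (t' * S j)) ≤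
    (∑' i, Real.exp (-N i * (t * S i))) - Real.exp (-N j * (t * S j)) := by
  classical
  have h1 := phi_summable N S hN hs e he hS t ht
  have h2 := phi_summable N S hN hs e he hS t' (ht.trans_le htt)
  have h3 : Summable fun i => Real.exp (-N i * (t * S i)) - Real.exp (-N i * (t' * S i)) :=
    h1.sub h2
  have h4 := h3.le_tsum j (fun i _ => by
    rw [sub_nonneg]
    apply Real.exp_le_exp.2
    have : t * S i ≤ t' * S i := by
      have := he.le.trans (hS i)
      gcongr
    have := mul_le_mul_of_nonneg_left this (zero_le_one.trans (hN i))
    linarith)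
  rw [h1.tsum_sub h2] at h4
  linarith

lemma phi_strict (N S : ι → ℝ) (hN : ∀ i, 1 ≤ N i)
    (hs : ∀ e : ℝ, 0 < e → Summable fun i => Real.exp (-e * N i))
    (e : ℝ) (he : 0 < e) (hS : ∀ i, e ≤ S i) (j : ι) {t t' : ℝ} (ht : 0 < t) (htt : t < t') :
    (∑' i, Real.exp (-N i * (t' * S i))) < (∑' i, Real.exp (-N i * (t * S i))) := by
  have h := phi_anti N S hN hs e he hS j ht htt.le
  have : Real.exp (-N j * (t' * S j)) < Real.exp (-N j * (t * S j)) := by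
    apply Real.exp_lt_exp.2
    have h1 : t * S j < t' * S j := by
      have := he.trans_le (hS j)
      gcongr
    have := mul_lt_mul_of_pos_left h1 (zero_lt_one.trans_le (hN j))
    linarith
  linarith

lemma phi_deriv_neg (N S : ι → ℝ) (hN : ∀ i, 1 ≤ N i)
    (hs : ∀ e : ℝ, 0 < e → Summable fun i => Real.exp (-e * N i))
    (e : ℝ) (he : 0 < e) (hS : ∀ i, e ≤ S i) (j : ι) {t : ℝ} (ht : 0 < t) (D : ℝ)
    (hD : HasDerivAt (fun t => ∑' i, Real.exp (-N i * (t * S i))) D t) : D < 0 := by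
  have h1 : HasDerivAt (fun t => Real.exp (-N j * (t * S j)))
      (Real.exp (-N j * (t * S j)) * (-N j * (1 * S j))) t :=
    (((hasDerivAt_id t).mul_const (S j)).const_mul (-N j)).exp
  have h2 := hD.sub h1
  have h3 : D - Real.exp (-N j * (t * S j)) * (-N j * (1 * S j)) ≤ 0 := by
    have h4 := h2.hasDerivWithinAt (s := Set.Ioi 0)
    have hanti : AntitoneOn ((fun t => ∑' i, Real.exp (-N i * (t * S i))) -
        fun t => Real.exp (-N j * (t * S j))) (Set.Ioi 0) := by
      intro a ha b hb hab
      exact phi_anti N S hN hs e he hS j ha hab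
    have h5 := hanti.derivWithin_nonpos (x := t)
    rwa [h4.derivWithin (isOpen_Ioi.uniqueDiffWithinAt ht)] at h5
  have h6 : 0 < Real.exp (-N j * (t * S j)) * (N j * S j) := by
    have := he.trans_le (hS j)
    have := zero_lt_one.trans_le (hN j)
    positivity
  nlinarith

lemma phi_exists (N S : ι → ℝ) (hN : ∀ i, 1 ≤ N i)
    (hs : ∀ e : ℝ, 0 < e → Summable fun i => Real.exp (-e * N i))
    (e : ℝ) (he : 0 < e) (hS : ∀ i, e ≤ S i) (j j' : ι) (hj : j ≠ j')
    (hc : ContinuousOn (fun t => ∑' i, Real.exp (-N i * (t * S i))) (Set.Ioi 0))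
    (κ : ℝ) (hκ : 0 < κ) (hκ1 : κ ≤ 1) :
    ∃ t, 0 < t ∧ ∑' i, Real.exp (-N i * (t * S i)) = κ := by
  classical
  have hpos : ∀ i, 0 < N i * S i := fun i =>
    mul_pos (zero_lt_one.trans_le (hN i)) (he.trans_le (hS i))
  -- small t
  obtain ⟨a, ha, haκ⟩ : ∃ a, 0 < a ∧ κ ≤ ∑' i, Real.exp (-N i * (a * S i)) := by
    set M := N j * S j + N j' * S j' with hM
    have hMp : 0 < M := add_pos (hpos j) (hpos j')
    refine ⟨1 / (2 * M), by positivity, hκ1.trans ?_⟩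
    have h1 := phi_summable N S hN hs e he hS (1 / (2 * M)) (by positivity)
    have h2 := h1.sum_le_tsum {j, j'} (fun i _ => (Real.exp_pos _).le)
    rw [Finset.sum_pair hj] at h2
    refine le_trans ?_ h2
    have key : ∀ i, N i * S i ≤ M → 1 / 2 ≤ Real.exp (-N i * (1 / (2 * M) * S i)) := by
      intro i hi
      have h3 := Real.add_one_le_exp (-N i * (1 / (2 * M) * S i))
      have h4 : N i * (1 / (2 * M) * S i) ≤ 1 / 2 := by
        have : N i * (1 / (2 * M) * S i) = (N i * S i) / (2 * M) := by ring
        rw [this, div_le_div_iff₀ (by positivity) (by norm_num)]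
        linarith
      linarith
    have := key j (by linarith [hpos j'])
    have := key j' (by linarith [hpos j])
    linarith
  -- large t
  obtain ⟨b, hab, hbκ⟩ : ∃ b, a ≤ b ∧ ∑' i, Real.exp (-N i * (b * S i)) ≤ κ := by
    have hsa := phi_summable N S hN hs e he hS a ha
    set T := ∑' i, Real.exp (-N i * (a * S i)) with hT
    have hTp : 0 < T := hκ.trans_le haκ
    have hlim : Filter.Tendsto (fun r : ℝ => Real.exp (-(r * e)) * T) Filter.atTop (𝓝 0) := by
      have := (Real.tendsto_exp_neg_atTop_nhds_zero.comp
        (Filter.tendsto_id.atTop_mul_const he)).mul_const T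
      simpa [Function.comp_def] using this
    obtain ⟨r, hr0, hr⟩ := ((Filter.eventually_ge_atTop (0:ℝ)).and
      (hlim.eventually (gt_mem_nhds hκ))).exists
    refine ⟨a + r, by linarith, le_trans ?_ hr.le⟩
    rw [hT, ← tsum_mul_left]
    refine Summable.tsum_le_tsum (fun i => ?_)
      (phi_summable N S hN hs e he hS (a + r) (by linarith)) (hsa.mul_left _)
    rw [← Real.exp_add]
    apply Real.exp_le_exp.2
    have h1 : e ≤ N i * S i := by
      have := mul_le_mul (hN i) (hS i) he.le (zero_le_one.trans (hN i))
      linarith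
    have h2 := mul_le_mul_of_nonneg_left h1 hr0
    nlinarith
  have hivt := intermediate_value_Icc' hab (hc.mono (fun t ht => ha.trans_le ht.1))
  obtain ⟨t, ht, htκ⟩ := hivt ⟨hbκ, haκ⟩
  exact ⟨t, ha.trans_le ht.1, htκ⟩

end partthree

section partfour
open scoped ContDiff

/-- The index set of nonzero integer vectors. -/
abbrev IV := {p : ℤ × ℤ // p ≠ 0}

/-- The weight `|a| + |b|`. -/
def NV (p : IV) : ℝ := |(p.1.1 : ℝ)| + |(p.1.2 : ℝ)|

lemma NV_ge (p : IV) : 1 ≤ NV p := by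
  obtain ⟨⟨a, b⟩, hp⟩ := p
  have h : 1 ≤ |a| + |b| := by
    by_contra hcon
    apply hp
    have ha := abs_nonneg a
    have hb := abs_nonneg b
    have ha0 : |a| = 0 := by omega
    have hb0 : |b| = 0 := by omega
    rw [abs_eq_zero] at ha0 hb0
    simp [ha0, hb0]
  simp only [NV]
  exact_mod_cast h

lemma NV_summable (e : ℝ) (he : 0 < e) : Summable fun p : IV => Real.exp (-e * NV p) := by
  have hnat : Summable fun m : ℕ => Real.exp (-e * (m : ℝ)) := by
    have := Real.summable_exp_nat_mul_iff.2 (neg_lt_zero.2 he)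
    simpa [mul_comm] using this
  have hz : Summable fun a : ℤ => Real.exp (-e * |(a : ℝ)|) := by
    refine Summable.of_nat_of_neg ?_ ?_
    · simpa using hnat
    · simpa using hnat
  have h2 := hz.mul_of_nonneg hz (fun _ => (Real.exp_pos _).le) (fun _ => (Real.exp_pos _).le)
  refine (h2.comp_injective (Subtype.val_injective (p := fun p : ℤ × ℤ => p ≠ 0))).congr ?_
  intro p
  simp only [Function.comp, NV]
  rw [← Real.exp_add]
  congr 1
  ring

instance : Nonempty IV := ⟨⟨(1, 0), by simp⟩⟩

lemma abs_fst_le (c : ℝ) (hc : 0 < c) (p : IV) : ‖(p.1.1 : ℝ) / (c * NV p)‖ ≤ 1 / c := by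
  have h := NV_ge p
  have hN : 0 < NV p := by linarith
  rw [norm_div, Real.norm_of_nonneg (by positivity : 0 ≤ c * NV p),
    div_le_div_iff₀ (by positivity) hc, Real.norm_eq_abs]
  have : |(p.1.1 : ℝ)| ≤ NV p := by simp only [NV]; linarith [abs_nonneg (p.1.2 : ℝ)]
  nlinarith

lemma abs_snd_le (c : ℝ) (hc : 0 < c) (p : IV) : ‖(p.1.2 : ℝ) / (c * NV p)‖ ≤ 1 / c := by
  have h := NV_ge p
  have hN : 0 < NV p := by linarith
  rw [norm_div, Real.norm_of_nonneg (by positivity : 0 ≤ c * NV p),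
    div_le_div_iff₀ (by positivity) hc, Real.norm_eq_abs]
  have : |(p.1.2 : ℝ)| ≤ NV p := by simp only [NV]; linarith [abs_nonneg (p.1.1 : ℝ)]
  nlinarith

/-- Normalised first coordinate. -/
def XV (c : ℝ) (hc : 0 < c) : IV →ᵇ ℝ :=
  BoundedContinuousFunction.ofNormedAddCommGroup (fun p => (p.1.1 : ℝ) / (c * NV p))
    continuous_of_discreteTopology (1 / c) (abs_fst_le c hc)

/-- Normalised second coordinate. -/
def YV (c : ℝ) (hc : 0 < c) : IV →ᵇ ℝ :=
  BoundedContinuousFunction.ofNormedAddCommGroup (fun p => (p.1.2 : ℝ) / (c * NV p))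
    continuous_of_discreteTopology (1 / c) (abs_snd_le c hc)

lemma XV_apply (c : ℝ) (hc : 0 < c) (p : IV) : XV c hc p = (p.1.1 : ℝ) / (c * NV p) := rfl
lemma YV_apply (c : ℝ) (hc : 0 < c) (p : IV) : YV c hc p = (p.1.2 : ℝ) / (c * NV p) := rfl

/-- The quadratic form. -/
def QV (c : ℝ) (hc : 0 < c) (g : Fin 2 → Fin 2 → ℝ) (p : IV) : ℝ :=
  (g 0 0 * XV c hc p + g 0 1 * YV c hc p) ^ 2 + (g 1 0 * XV c hc p + g 1 1 * YV c hc p) ^ 2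

lemma QV_lower (c : ℝ) (hc : 0 < c) (g : Fin 2 → Fin 2 → ℝ)
    (hg : g 0 0 * g 1 1 - g 0 1 * g 1 0 ≠ 0) :
    ∃ d : ℝ, 0 < d ∧ ∀ p, d ≤ QV c hc g p := by
  set D := g 0 0 * g 1 1 - g 0 1 * g 1 0 with hD
  set W := g 0 0 ^ 2 + g 0 1 ^ 2 + g 1 0 ^ 2 + g 1 1 ^ 2 with hW
  have hDp : 0 < D ^ 2 := by positivity
  have hWp : 0 < W := by
    nlinarith [sq_nonneg (g 0 0 - g 1 1), sq_nonneg (g 0 0 + g 1 1), sq_nonneg (g 0 1 + g 1 0),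
      sq_nonneg (g 0 1 - g 1 0), abs_pos.2 hg, abs_le.1 (le_refl |D|), le_abs_self D,
      neg_abs_le D, abs_nonneg D, abs_cases D]
  refine ⟨D ^ 2 / (2 * c ^ 2) / W, by positivity, fun p => ?_⟩
  rw [div_le_iff₀ hWp]
  have hN : 0 < NV p := by linarith [NV_ge p]
  have hxy : 1 / (2 * c ^ 2) ≤ XV c hc p ^ 2 + YV c hc p ^ 2 := by
    rw [XV_apply, YV_apply, div_pow, div_pow, ← add_div,
      div_le_div_iff₀ (by positivity) (by positivity), mul_pow]
    have : NV p ^ 2 ≤ 2 * ((p.1.1 : ℝ) ^ 2 + (p.1.2 : ℝ) ^ 2) := by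
      simp only [NV]
      rw [← sq_abs (p.1.1 : ℝ), ← sq_abs (p.1.2 : ℝ)]
      nlinarith [sq_nonneg (|(p.1.1 : ℝ)| - |(p.1.2 : ℝ)|)]
    nlinarith [sq_nonneg c, mul_le_mul_of_nonneg_left this (sq_nonneg c)]
  have h1 : D ^ 2 / (2 * c ^ 2) ≤ D ^ 2 * (XV c hc p ^ 2 + YV c hc p ^ 2) := by
    calc D ^ 2 / (2 * c ^ 2) = D ^ 2 * (1 / (2 * c ^ 2)) := by ring
      _ ≤ _ := by gcongr
  refine h1.trans ?_
  simp only [QV]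
  set x := XV c hc p
  set y := YV c hc p
  set P := g 0 0 * x + g 0 1 * y with hP
  set R := g 1 0 * x + g 1 1 * y with hR
  have hx : D * x = g 1 1 * P - g 0 1 * R := by rw [hD, hP, hR]; ring
  have hy : D * y = g 0 0 * R - g 1 0 * P := by rw [hD, hP, hR]; ring
  have hsq : D ^ 2 * (x ^ 2 + y ^ 2) = (D * x) ^ 2 + (D * y) ^ 2 := by ring
  rw [hsq, hx, hy, hW]
  nlinarith [sq_nonneg (g 1 1 * R + g 0 1 * P), sq_nonneg (g 0 0 * P + g 1 0 * R)]

/-- The lattice vector attached to an index. -/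
def vecV (c : ℝ) (p : IV) : EuclideanSpace ℝ (Fin 2) := !₂[(p.1.1 : ℝ) / c, (p.1.2 : ℝ) / c]

lemma act_norm (c : ℝ) (hc : 0 < c) (g : Fin 2 → Fin 2 → ℝ) (p : IV) :
    ‖act (Matrix.of g) (vecV c p)‖ = NV p * √(QV c hc g p) := by
  have hN : 0 < NV p := by linarith [NV_ge p]
  rw [EuclideanSpace.norm_eq, Fin.sum_univ_two]
  have h0 : (act (Matrix.of g) (vecV c p)) 0
      = NV p * (g 0 0 * XV c hc p + g 0 1 * YV c hc p) := by
    simp [act, vecV, XV_apply, YV_apply]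
    field_simp
    rfl
  have h1 : (act (Matrix.of g) (vecV c p)) 1
      = NV p * (g 1 0 * XV c hc p + g 1 1 * YV c hc p) := by
    simp [act, vecV, XV_apply, YV_apply]
    field_simp
    rfl
  rw [h0, h1, Real.norm_eq_abs, Real.norm_eq_abs, sq_abs, sq_abs, mul_pow, mul_pow, ← mul_add,
    Real.sqrt_mul (by positivity), Real.sqrt_sq hN.le]
  rfl

lemma act_inj (g : Fin 2 → Fin 2 → ℝ) (hg : IsUnit (Matrix.of g).det) :
    Function.Injective (act (Matrix.of g)) := by
  intro v w h
  simp only [act] at h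
  have h1 := (WithLp.equiv 2 (Fin 2 → ℝ)).symm.injective h
  have h2 := Matrix.mulVec_injective_of_isUnit ((Matrix.isUnit_iff_isUnit_det _).2 hg) h1
  exact (WithLp.equiv 2 (Fin 2 → ℝ)).injective h2

lemma vec_inj (c : ℝ) (hc : 0 < c) : Function.Injective (vecV c) := by
  intro p q h
  have h0 := congrArg (fun v : EuclideanSpace ℝ (Fin 2) => v 0) h
  have h1 := congrArg (fun v : EuclideanSpace ℝ (Fin 2) => v 1) h
  simp only [vecV] at h0 h1
  simp [div_left_inj' hc.ne'] at h0 h1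
  exact Subtype.ext (Prod.ext h0 h1)

lemma Lam_eq (n k : ℕ) : Lam n k = Set.range (vecV (√(n * (k + 1)))) := by
  ext v
  simp only [Lam, Set.mem_ofPred_eq, Set.mem_range]
  constructor
  · rintro ⟨a, b, hab, h0, h1⟩
    refine ⟨⟨(a, b), fun h => hab (by simpa [Prod.ext_iff] using h)⟩, ?_⟩
    ext i
    fin_cases i
    · simp [vecV, h0]
    · simp [vecV, h1]
  · rintro ⟨⟨⟨a, b⟩, hp⟩, rfl⟩
    exact ⟨a, b, fun h => hp (by simp [h.1, h.2]), by simp [vecV], by simp [vecV]⟩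

lemma fEnt_eq (n k : ℕ) (hc : 0 < √((n : ℝ) * (k + 1))) (t : ℝ) (g : Fin 2 → Fin 2 → ℝ)
    (hg : IsUnit (Matrix.of g).det) :
    fEnt n k t (Matrix.of g) = ∑' p : IV, Real.exp (-NV p * (t * √(QV _ hc g p))) := by
  have hr : act (Matrix.of g) '' Lam n k
      = Set.range (act (Matrix.of g) ∘ vecV (√(n * (k + 1)))) := by
    rw [Lam_eq, Set.range_comp]
  simp only [fEnt]
  rw [hr, tsum_range (fun v => Real.exp (-t * ‖v‖)) ((act_inj g hg).comp (vec_inj _ hc))]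
  refine tsum_congr (fun p => ?_)
  simp only [Function.comp]
  rw [act_norm _ hc]
  congr 1
  ring

end partfour

/-- There is a function `H` assigning to each invertible 2×2 real matrix `A`
the unique solution `H(A) > 0` of `f_{H(A)}(A) = 1/k`, and `H` is real-analytic
on the set of invertible matrices. -/
theorem entropy_realAnalytic
    (n k : ℕ) (hn : 1 ≤ n) (hk : 1 ≤ k) :
    ∃ H : Matrix (Fin 2) (Fin 2) ℝ → ℝ,
      (∀ A : Matrix (Fin 2) (Fin 2) ℝ, IsUnit A.det →
        0 < H A ∧ fEnt n k (H A) A = 1 / (k : ℝ)) ∧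
      AnalyticOnNhd ℝ (fun g : Fin 2 → Fin 2 → ℝ => H (Matrix.of g))
        {g : Fin 2 → Fin 2 → ℝ | IsUnit (Matrix.of g).det} := by
  have hn' : (1 : ℝ) ≤ n := by exact_mod_cast hn
  have hk' : (1 : ℝ) ≤ k := by exact_mod_cast hk
  have hc : 0 < √((n : ℝ) * (k + 1)) := Real.sqrt_pos.2 (by positivity)
  have hN0 : ∀ p, 0 ≤ NV p := fun p => zero_le_one.trans (NV_ge p)
  have hκ : (0 : ℝ) < 1 / k := by positivity
  have hκ1 : (1 : ℝ) / k ≤ 1 := by rw [div_le_one (by positivity)]; exact hk'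
  have j0 : IV := ⟨(1, 0), by simp⟩
  let F : (Fin 2 → Fin 2 → ℝ) × ℝ → ℝ := fun z =>
    ∑' p : IV, Real.exp (-NV p * (z.2 * √(QV _ hc z.1 p)))
  have hdet : ∀ g : Fin 2 → Fin 2 → ℝ, IsUnit (Matrix.of g).det →
      g 0 0 * g 1 1 - g 0 1 * g 1 0 ≠ 0 := by
    intro g hg
    rw [Matrix.det_fin_two] at hg
    exact hg.ne_zero
  have hFan : ∀ g t, IsUnit (Matrix.of g).det → 0 < t → AnalyticAt ℝ F (g, t) := by
    intro g t hg ht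
    obtain ⟨d, hd, hdq⟩ := QV_lower _ hc g (hdet g hg)
    exact Phi_analyticAt NV hN0 NV_summable (XV _ hc) (YV _ hc) g t ht d hd hdq
  have hlow : ∀ g : Fin 2 → Fin 2 → ℝ, IsUnit (Matrix.of g).det →
      ∃ e : ℝ, 0 < e ∧ ∀ p, e ≤ √(QV _ hc g p) := by
    intro g hg
    obtain ⟨d, hd, hdq⟩ := QV_lower _ hc g (hdet g hg)
    exact ⟨√d, Real.sqrt_pos.2 hd, fun p => Real.sqrt_le_sqrt (hdq p)⟩
  have hline : ∀ g t, IsUnit (Matrix.of g).det → 0 < t →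
      HasDerivAt (fun t => F (g, t)) (fderiv ℝ F (g, t) (0, 1)) t := by
    intro g t hg ht
    have h1 := (hFan g t hg ht).differentiableAt.hasFDerivAt
    have h2 : HasDerivAt (fun s : ℝ => (g, s)) ((0 : Fin 2 → Fin 2 → ℝ), (1 : ℝ)) t :=
      (hasDerivAt_const t g).prodMk (hasDerivAt_id t)
    exact h1.comp_hasDerivAt t h2
  have hex : ∀ g : Fin 2 → Fin 2 → ℝ, IsUnit (Matrix.of g).det →
      ∃ t, 0 < t ∧ F (g, t) = 1 / k := by
    intro g hg
    obtain ⟨e, he, hS⟩ := hlow g hg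
    exact phi_exists NV (fun p => √(QV _ hc g p)) NV_ge NV_summable e he hS
      ⟨(1, 0), by simp⟩ ⟨(0, 1), by simp⟩ (by simp)
      (fun t ht => (hline g t hg ht).continuousAt.continuousWithinAt) _ hκ hκ1
  have hun : ∀ g t t', IsUnit (Matrix.of g).det → 0 < t → 0 < t' → F (g, t) = F (g, t') →
      t = t' := by
    intro g t t' hg ht ht' h
    obtain ⟨e, he, hS⟩ := hlow g hg
    rcases lt_trichotomy t t' with hlt | heq | hlt
    · exact absurd h (phi_strict NV (fun p => √(QV _ hc g p)) NV_ge NV_summable e he hS j0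
        ht hlt).ne'
    · exact heq
    · exact absurd h (phi_strict NV (fun p => √(QV _ hc g p)) NV_ge NV_summable e he hS j0
        ht' hlt).ne
  choose! h0 hpos hsol using hex
  refine ⟨fun A => h0 A, ?_, ?_⟩
  · intro A hA
    refine ⟨hpos A hA, ?_⟩
    have := fEnt_eq n k hc (h0 A) A hA
    exact this.trans (hsol A hA)
  · intro g hg
    change AnalyticAt ℝ (fun g => h0 g) g
    have hcd : ContDiffAt ℝ (⊤ : WithTop ℕ∞) F (g, h0 g) := (hFan g (h0 g) hg (hpos g hg)).contDiffAt
    have hDneg : fderiv ℝ F (g, h0 g) (0, 1) < 0 := by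
      obtain ⟨e, he, hS⟩ := hlow g hg
      exact phi_deriv_neg NV (fun p => √(QV _ hc g p)) NV_ge NV_summable e he hS j0
        (hpos g hg) _ (hline g (h0 g) hg (hpos g hg))
    have hinv : (fderiv ℝ F (g, h0 g) ∘L .inr ℝ (Fin 2 → Fin 2 → ℝ) ℝ).IsInvertible := by
      refine ContinuousLinearMap.IsInvertible.of_inverse
        (g := (fderiv ℝ F (g, h0 g) (0, 1))⁻¹ • ContinuousLinearMap.id ℝ ℝ) ?_ ?_
      · ext
        simp [hDneg.ne]
      · ext
        simp [hDneg.ne]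
    have hψ := (hcd.contDiffAt_implicitFunction (by simp) hinv).analyticAt
    have hψ0 := hcd.implicitFunction_apply_self (by simp) hinv
    have hψe := hcd.eventually_apply_implicitFunction (by simp) hinv
    refine hψ.congr ?_
    have hopen : ∀ᶠ g' in 𝓝 g, IsUnit (Matrix.of g').det := by
      have hcont : Continuous fun g' : Fin 2 → Fin 2 → ℝ => (Matrix.of g').det := by
        simp only [Matrix.det_fin_two, Matrix.of_apply]
        fun_prop
      have := hcont.continuousAt.eventually_ne hg.ne_zero
      exact this.mono fun _ h => isUnit_iff_ne_zero.2 h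
    have hpos' : ∀ᶠ g' in 𝓝 g, 0 < hcd.implicitFunction (by simp) hinv g' := by
      have hcc := hψ.continuousAt
      rw [ContinuousAt, hψ0] at hcc
      exact hcc.eventually (lt_mem_nhds (hpos g hg))
    filter_upwards [hψe, hopen, hpos'] with g' h1 h2 h3
    exact hun g' _ _ h2 h3 (hpos g' h2) (by rw [h1, hsol g hg, hsol g' h2])
end
end

section
/- (Montgomery's Theorem) For every t > 0 and every unimodular lattice L = A(ℤ²) with A ∈ SL(2,ℝ), one has F_t(L) ≥ F_t(L_Δ), with equality if and only if L = R(L_Δ) for some rotation R ∈ SO(2). -/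
noncomputable section

/-- The standard integer lattice `ℤ² ⊂ ℝ²`. -/
def intLat : Set (EuclideanSpace ℝ (Fin 2)) :=
  {v | ∃ a b : ℤ, v 0 = (a : ℝ) ∧ v 1 = (b : ℝ)}

/-- The unimodular equilateral triangular lattice, spanned by `c•(1,0)` and
`c•(1/2, √3/2)` with `c = (2/√3)^(1/2)`, so that its covolume is `1`. -/
def triLat : Set (EuclideanSpace ℝ (Fin 2)) :=
  {v | ∃ a b : ℤ,
    v 0 = (a : ℝ) * Real.sqrt (2 / Real.sqrt 3)
        + (b : ℝ) * Real.sqrt (2 / Real.sqrt 3) / 2 ∧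
    v 1 = (b : ℝ) * Real.sqrt (2 / Real.sqrt 3) * Real.sqrt 3 / 2}

/-- `F_t(L) = ∑_{p ∈ L \ {0}} exp (-t ‖p‖²)`. -/
def FTheta (t : ℝ) (L : Set (EuclideanSpace ℝ (Fin 2))) : ℝ :=
  ∑' p : (L \ {0} : Set (EuclideanSpace ℝ (Fin 2))),
    Real.exp (-t * ‖(p : EuclideanSpace ℝ (Fin 2))‖ ^ 2)

/-- `R` belongs to the rotation group `SO(2)`. -/
def IsRotation (R : Matrix (Fin 2) (Fin 2) ℝ) : Prop :=
  R.det = 1 ∧ R * R.transpose = 1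

section montAux
open Real

/-- geometric series over `ℤ` -/
lemma hasSum_geom_int {r : ℝ} (h0 : 0 ≤ r) (h1 : r < 1) :
    HasSum (fun n : ℤ => r ^ n.natAbs) ((1 + r) / (1 - r)) := by
  have h := hasSum_geometric_of_lt_one h0 h1
  have h2 := h.mul_left r
  have h3 := HasSum.of_nat_of_neg_add_one (f := fun n : ℤ => r ^ n.natAbs) (m := (1 - r)⁻¹)
    (m' := r * (1 - r)⁻¹) (by simpa using h) (by
      have : (fun n : ℕ => r ^ (-((n : ℤ) + 1)).natAbs) = fun n : ℕ => r * r ^ n := by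
        funext n
        have : (-((n : ℤ) + 1)).natAbs = n + 1 := by omega
        rw [this, pow_succ, mul_comm]
      rw [this]; exact h2)
  convert h3 using 1
  have : (1 - r) ≠ 0 := by linarith
  field_simp

lemma natAbs_le_sq (n : ℤ) : (n.natAbs : ℝ) ≤ (n : ℝ) ^ 2 := by
  have h : n.natAbs ≤ n.natAbs ^ 2 := Nat.le_self_pow (by norm_num) _
  have h2 : ((n.natAbs ^ 2 : ℕ) : ℝ) = (n : ℝ) ^ 2 := by
    have := congrArg (fun z : ℤ => (z : ℝ)) (Int.natAbs_sq n)
    push_cast at this ⊢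
    simpa using this
  rw [← h2]; exact_mod_cast h

lemma exp_sq_le_geom {c : ℝ} (hc : 0 < c) (n : ℤ) :
    exp (-c * (n : ℝ) ^ 2) ≤ exp (-c) ^ n.natAbs := by
  rw [← Real.exp_nat_mul]
  apply Real.exp_le_exp.mpr
  nlinarith [natAbs_le_sq n]

lemma summable_gauss {c : ℝ} (hc : 0 < c) : Summable (fun n : ℤ => exp (-c * (n : ℝ) ^ 2)) := by
  refine Summable.of_nonneg_of_le (fun n => (exp_pos _).le) (fun n => exp_sq_le_geom hc n) ?_
  exact (hasSum_geom_int (exp_pos _).le (by rw [Real.exp_lt_one_iff]; linarith)).summable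

/-- One-dimensional theta function. -/
noncomputable def Th (t β : ℝ) : ℝ := ∑' k : ℤ, exp (-π * t * (k : ℝ) ^ 2) * cos (2 * π * k * β)

lemma summable_Th {t : ℝ} (ht : 0 < t) (β : ℝ) :
    Summable (fun k : ℤ => exp (-π * t * (k : ℝ) ^ 2) * cos (2 * π * k * β)) := by
  have h := summable_gauss (c := π * t) (by positivity)
  refine Summable.of_norm_bounded h ?_
  intro k
  rw [norm_mul, Real.norm_of_nonneg (exp_pos _).le]
  have : ‖cos (2 * π * k * β)‖ ≤ 1 := Real.abs_cos_le_one _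
  have h3 := exp_pos (-π * t * (k : ℝ) ^ 2)
  calc _ ≤ exp (-π * t * (k : ℝ) ^ 2) * 1 := by gcongr
    _ = _ := by rw [mul_one]; ring_nf

lemma summable_shift {s : ℝ} (hs : 0 < s) (β : ℝ) :
    Summable (fun m : ℤ => exp (-π * s * ((m : ℝ) + β) ^ 2)) := by
  have h := (summable_gauss (c := π * s / 2) (by positivity)).mul_left (exp (π * s * β ^ 2))
  refine Summable.of_nonneg_of_le (fun n => (exp_pos _).le) (fun n => ?_) h
  rw [← Real.exp_add]
  apply Real.exp_le_exp.mpr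
  have : 0 < π * s := by positivity
  nlinarith [mul_nonneg this.le (sq_nonneg ((n : ℝ) + 2 * β))]

lemma poisson {s : ℝ} (hs : 0 < s) (β : ℝ) :
    ∑' m : ℤ, exp (-π * s * ((m : ℝ) + β) ^ 2) = √(1 / s) * Th (1 / s) β := by
  have ht : 0 < 1 / s := by positivity
  have h := Complex.tsum_exp_neg_quadratic (a := ((1 / s : ℝ) : ℂ)) (by simpa using hs)
    (-Complex.I * β)
  have e1 : (∑' n : ℤ, Complex.exp (-π * ((1 / s : ℝ) : ℂ) * n ^ 2 + 2 * π * (-Complex.I * β) * n)).re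
      = Th (1 / s) β := by
    have hsum : Summable (fun n : ℤ =>
        Complex.exp (-π * ((1 / s : ℝ) : ℂ) * n ^ 2 + 2 * π * (-Complex.I * β) * n)) := by
      refine Summable.of_norm_bounded (summable_gauss (c := π * (1 / s)) (by positivity)) ?_
      intro n
      rw [Complex.norm_exp]
      apply Real.exp_le_exp.mpr
      have : (-π * ((1 / s : ℝ) : ℂ) * n ^ 2 + 2 * π * (-Complex.I * β) * n)
        = ((-π * (1 / s) * (n : ℝ) ^ 2 : ℝ) : ℂ) + ((-(2 * π * n * β) : ℝ) : ℂ) * Complex.I := by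
        push_cast; ring
      rw [this, Complex.add_re, Complex.re_ofReal_mul, Complex.I_re, Complex.ofReal_re]
      linarith
    rw [Complex.re_tsum hsum]
    unfold Th
    refine tsum_congr fun n => ?_
    have : (-π * ((1 / s : ℝ) : ℂ) * n ^ 2 + 2 * π * (-Complex.I * β) * n)
        = ((-π * (1 / s) * (n : ℝ) ^ 2 : ℝ) : ℂ) + ((-(2 * π * n * β) : ℝ) : ℂ) * Complex.I := by
        push_cast; ring
    rw [this, Complex.exp_re, Complex.add_re, Complex.re_ofReal_mul, Complex.I_re, Complex.ofReal_re,
      Complex.add_im, Complex.im_ofReal_mul, Complex.I_im, Complex.ofReal_im]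
    simp only [mul_zero, add_zero, zero_add, mul_one, Real.cos_neg]
  have e2 : (∑' n : ℤ, Complex.exp (-π / ((1 / s : ℝ) : ℂ) * (n + Complex.I * (-Complex.I * β)) ^ 2))
      = ((∑' m : ℤ, exp (-π * s * ((m : ℝ) + β) ^ 2) : ℝ) : ℂ) := by
    rw [Complex.ofReal_tsum]
    refine tsum_congr fun n => ?_
    rw [Complex.ofReal_exp]
    congr 1
    push_cast
    have : Complex.I * (-Complex.I * β) = β := by
      linear_combination (-(β : ℂ)) * Complex.I_mul_I
    rw [this]
    have : (s : ℂ) ≠ 0 := by exact_mod_cast hs.ne'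
    field_simp
  rw [e2] at h
  have h3 := congrArg Complex.re h
  rw [e1] at h3
  have e3 : (1 / (((1 / s : ℝ) : ℂ)) ^ (1 / 2 : ℂ)) = ((1 / √(1 / s) : ℝ) : ℂ) := by
    rw [Real.sqrt_eq_rpow]
    generalize 1 / s = t at ht
    rw [Complex.ofReal_div, Complex.ofReal_cpow ht.le]
    norm_num
  rw [e3, ← Complex.ofReal_mul, Complex.ofReal_re] at h3
  rw [h3]
  have : √(1 / s) ≠ 0 := by positivity
  field_simp

/-- inverse `q`-factorials, extended by zero -/
noncomputable def eQ (Q : ℝ) (j : ℤ) : ℝ :=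
  if j < 0 then 0 else ∏ i ∈ Finset.range j.toNat, (1 - Q ^ (i + 1))⁻¹

lemma one_sub_pow_pos {Q : ℝ} (h0 : 0 < Q) (h1 : Q < 1) (n : ℕ) : 0 < 1 - Q ^ (n + 1) := by
  have : Q ^ (n + 1) < 1 := pow_lt_one₀ h0.le h1 (Nat.succ_ne_zero n)
  linarith

lemma eQ_pred {Q : ℝ} (h0 : 0 < Q) (h1 : Q < 1) (j : ℤ) : eQ Q (j - 1) = (1 - Q ^ j) * eQ Q j := by
  unfold eQ
  rcases lt_trichotomy j 0 with h | h | h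
  · rw [if_pos (by omega), if_pos h, mul_zero]
  · subst h; simp
  · obtain ⟨n, rfl⟩ : ∃ n : ℕ, j = n + 1 := ⟨(j - 1).toNat, by omega⟩
    rw [if_neg (by omega), if_neg (by omega)]
    have e1 : ((n : ℤ) + 1 - 1).toNat = n := by omega
    have e2 : ((n : ℤ) + 1).toNat = n + 1 := by omega
    rw [e1, e2, Finset.prod_range_succ]
    have := (one_sub_pow_pos h0 h1 n).ne'
    have e3 : Q ^ ((n : ℤ) + 1) = Q ^ (n + 1) := by
      rw [← zpow_natCast]; norm_num
    rw [e3]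
    field_simp

lemma eQ_nonneg {Q : ℝ} (h0 : 0 < Q) (h1 : Q < 1) (j : ℤ) : 0 ≤ eQ Q j := by
  unfold eQ
  split_ifs
  · exact le_rfl
  · exact Finset.prod_nonneg fun i _ => (inv_pos.mpr (one_sub_pow_pos h0 h1 i)).le

lemma eQ_pos {Q : ℝ} (h0 : 0 < Q) (h1 : Q < 1) (n : ℕ) : 0 < eQ Q n := by
  unfold eQ
  rw [if_neg (by omega)]
  exact Finset.prod_pos fun i _ => (inv_pos.mpr (one_sub_pow_pos h0 h1 i))

noncomputable def cQ (Q : ℝ) (N : ℕ) : ℝ := ∏ i ∈ Finset.range (2 * N), (1 - Q ^ (i + 1))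

lemma cQ_pos {Q : ℝ} (h0 : 0 < Q) (h1 : Q < 1) (n : ℕ) : 0 < cQ Q n :=
  Finset.prod_pos fun i _ => one_sub_pow_pos h0 h1 i

noncomputable def DQ (q : ℝ) (N : ℕ) (k : ℤ) : ℝ :=
  cQ (q ^ 2) N * q ^ (k ^ 2) * eQ (q ^ 2) (N + k) * eQ (q ^ 2) (N - k)

lemma DQ_succ {q : ℝ} (h0 : 0 < q) (h1 : q < 1) (N : ℕ) (k : ℤ) :
    DQ q (N + 1) k = (1 + q ^ (2 * (2 * N + 1))) * DQ q N k
      + q ^ (2 * N + 1) * (DQ q N (k - 1) + DQ q N (k + 1)) := by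
  have hQ0 : 0 < q ^ 2 := by positivity
  have hQ1 : q ^ 2 < 1 := pow_lt_one₀ h0.le h1 (by norm_num)
  have hq := h0.ne'
  unfold DQ
  have ec : cQ (q ^ 2) (N + 1) = cQ (q ^ 2) N * (1 - (q ^ 2) ^ (2 * N + 1)) * (1 - (q ^ 2) ^ (2 * N + 2)) := by
    unfold cQ
    rw [show 2 * (N + 1) = 2 * N + 1 + 1 by ring, Finset.prod_range_succ, Finset.prod_range_succ]
  have a1 : eQ (q ^ 2) ((N : ℤ) + k) = (1 - (q ^ 2) ^ ((N : ℤ) + 1 + k)) * eQ (q ^ 2) ((N : ℤ) + 1 + k) := by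
    rw [← eQ_pred hQ0 hQ1]; congr 1; ring
  have b1 : eQ (q ^ 2) ((N : ℤ) - k) = (1 - (q ^ 2) ^ ((N : ℤ) + 1 - k)) * eQ (q ^ 2) ((N : ℤ) + 1 - k) := by
    rw [← eQ_pred hQ0 hQ1]; congr 1; ring
  have a2 : eQ (q ^ 2) ((N : ℤ) + (k - 1)) = (1 - (q ^ 2) ^ ((N : ℤ) + k)) * eQ (q ^ 2) ((N : ℤ) + k) := by
    rw [← eQ_pred hQ0 hQ1]; congr 1; ring
  have b2 : eQ (q ^ 2) ((N : ℤ) - (k + 1)) = (1 - (q ^ 2) ^ ((N : ℤ) - k)) * eQ (q ^ 2) ((N : ℤ) - k) := by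
    rw [← eQ_pred hQ0 hQ1]; congr 1; ring
  have a3 : (N : ℤ) - (k - 1) = N + 1 - k := by ring
  have b3 : (N : ℤ) + (k + 1) = N + 1 + k := by ring
  rw [ec, a2, b2, a3, b3, a1, b1]
  push_cast
  generalize eQ (q ^ 2) ((N : ℤ) + 1 + k) = E1
  generalize eQ (q ^ 2) ((N : ℤ) + 1 - k) = E2
  -- powers
  set X : ℝ := (q ^ 2) ^ ((N : ℤ) + k) with hX
  set Y : ℝ := (q ^ 2) ^ ((N : ℤ) - k) with hY
  have hX1 : (q ^ 2) ^ ((N : ℤ) + 1 + k) = q ^ 2 * X := by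
    rw [hX, show (N : ℤ) + 1 + k = 1 + (N + k) by ring, zpow_add₀ hQ0.ne', zpow_one]
  have hY1 : (q ^ 2) ^ ((N : ℤ) + 1 - k) = q ^ 2 * Y := by
    rw [hY, show (N : ℤ) + 1 - k = 1 + (N - k) by ring, zpow_add₀ hQ0.ne', zpow_one]
  have hXY : X * Y = (q ^ 2) ^ (2 * N) := by
    rw [hX, hY, ← zpow_add₀ hQ0.ne', ← zpow_natCast (q ^ 2) (2 * N)]; congr 1; push_cast; ring
  have p1 : (q ^ 2) ^ (2 * N + 1) = q ^ 2 * (X * Y) := by rw [hXY]; ring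
  have p2 : (q ^ 2) ^ (2 * N + 2) = q ^ 4 * (X * Y) := by rw [hXY]; ring
  have p3 : q ^ (2 * (2 * N + 1)) = q ^ 2 * (X * Y) := by rw [hXY]; ring
  have r1 : q ^ (2 * N + 1) * q ^ ((k - 1) ^ 2) = q ^ (k ^ 2) * (q ^ 2 * Y) := by
    rw [hY, ← zpow_natCast q (2 * N + 1), ← zpow_add₀ hq, ← zpow_natCast q 2, ← zpow_mul, ← zpow_add₀ hq,
      ← zpow_add₀ hq]
    congr 1; push_cast; ring
  have r2 : q ^ (2 * N + 1) * q ^ ((k + 1) ^ 2) = q ^ (k ^ 2) * (q ^ 2 * X) := by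
    rw [hX, ← zpow_natCast q (2 * N + 1), ← zpow_add₀ hq, ← zpow_natCast q 2, ← zpow_mul, ← zpow_add₀ hq,
      ← zpow_add₀ hq]
    congr 1; push_cast; ring
  rw [hX1, hY1, p1, p2, p3, mul_add]
  have : ∀ c A B E F : ℝ, q ^ (2 * N + 1) * (c * A * E * F) = c * (q ^ (2 * N + 1) * A) * E * F := by
    intros; ring
  rw [this _ (q ^ ((k - 1) ^ 2)), this _ (q ^ ((k + 1) ^ 2)), r1, r2]
  · ring
  · exact 0
  · exact 0

lemma hasSum_DQ {q : ℝ} (h0 : 0 < q) (h1 : q < 1) (z : ℂ) (hz : z ≠ 0) (N : ℕ) :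
    HasSum (fun k : ℤ => (DQ q N k : ℂ) * z ^ k)
      (∏ r ∈ Finset.range N, ((1 + (q : ℂ) ^ (2 * (2 * r + 1))) + q ^ (2 * r + 1) * (z + z⁻¹))) := by
  induction N with
  | zero =>
    have : HasSum (fun k : ℤ => (DQ q 0 k : ℂ) * z ^ k) ((DQ q 0 0 : ℂ) * z ^ (0 : ℤ)) := by
      apply hasSum_single
      intro k hk
      have : DQ q 0 k = 0 := by
        unfold DQ eQ
        rcases lt_or_gt_of_ne hk with h | h
        · simp [h]
        · simp [h]
      simp [this]
    simpa [DQ, eQ, cQ] using this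
  | succ N ih =>
    rw [Finset.prod_range_succ]
    have s1 := (ih.mul_right z)
    have s2 := (ih.mul_right z⁻¹)
    rw [← (Equiv.subRight (1 : ℤ)).hasSum_iff] at s1
    rw [← (Equiv.addRight (1 : ℤ)).hasSum_iff] at s2
    have s3 := (ih.mul_left (1 + (q : ℂ) ^ (2 * (2 * N + 1)))).add
      ((s1.add s2).mul_left ((q : ℂ) ^ (2 * N + 1)))
    have e1 : (fun k : ℤ => (DQ q (N + 1) k : ℂ) * z ^ k) = fun b =>
        (1 + (q : ℂ) ^ (2 * (2 * N + 1))) * (↑(DQ q N b) * z ^ b) + (q : ℂ) ^ (2 * N + 1) *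
          (((fun i : ℤ => (DQ q N i : ℂ) * z ^ i * z) ∘ ⇑(Equiv.subRight 1)) b +
            ((fun i : ℤ => (DQ q N i : ℂ) * z ^ i * z⁻¹) ∘ ⇑(Equiv.addRight 1)) b) := by
      funext k
      simp only [Function.comp, Equiv.subRight_apply, Equiv.coe_addRight]
      rw [DQ_succ h0 h1, zpow_sub_one₀ hz, zpow_add_one₀ hz]
      push_cast
      field_simp
    have e2 : ∀ P : ℂ, P * (1 + (q : ℂ) ^ (2 * (2 * N + 1)) + (q : ℂ) ^ (2 * N + 1) * (z + z⁻¹)) =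
      (1 + (q : ℂ) ^ (2 * (2 * N + 1))) * P + (q : ℂ) ^ (2 * N + 1) * (P * z + P * z⁻¹) := by
      intro P; ring
    rw [e1, e2]
    exact s3

/-- The finite product. -/
noncomputable def PQ (q : ℝ) (N : ℕ) (s : ℝ) : ℝ :=
  ∏ r ∈ Finset.range N, (1 + (q ^ (2 * r + 1)) ^ 2 + 2 * q ^ (2 * r + 1) * s)

lemma hasSum_PQ {q : ℝ} (h0 : 0 < q) (h1 : q < 1) (φ : ℝ) (N : ℕ) :
    HasSum (fun k : ℤ => DQ q N k * cos (k * φ)) (PQ q N (cos φ)) := by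
  have h := hasSum_DQ h0 h1 (Complex.exp (φ * Complex.I)) (Complex.exp_ne_zero _) N
  have h2 := Complex.hasSum_re h
  convert h2 using 1
  · funext k
    rw [← Complex.exp_int_mul, ← mul_assoc]
    rw [show ((k : ℂ) * (φ : ℂ)) = ((k * φ : ℝ) : ℂ) by push_cast; rfl]
    rw [Complex.re_ofReal_mul, Complex.exp_ofReal_mul_I_re]
  · have : (∏ r ∈ Finset.range N, ((1 + (q : ℂ) ^ (2 * (2 * r + 1))) + q ^ (2 * r + 1) *
      (Complex.exp (φ * Complex.I) + (Complex.exp (φ * Complex.I))⁻¹))) = ((PQ q N (cos φ) : ℝ) : ℂ) := by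
      unfold PQ
      push_cast
      refine Finset.prod_congr rfl fun r _ => ?_
      rw [← Complex.exp_neg, Complex.cos]
      ring_nf
    rw [this, Complex.ofReal_re]

lemma eQ_mul_le {Q : ℝ} (h0 : 0 < Q) (h1 : Q < 1) (N : ℕ) (k : ℕ) :
    eQ Q (N + k) * eQ Q (N - k) ≤ eQ Q N ^ 2 := by
  induction k with
  | zero => simp [sq]
  | succ k ih =>
    refine le_trans ?_ ih
    push_cast
    have e1 := eQ_pred h0 h1 ((N : ℤ) - k)
    have e2 := eQ_pred h0 h1 ((N : ℤ) + k + 1)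
    rw [show (N : ℤ) + k + 1 - 1 = N + k by ring] at e2
    rw [show (N : ℤ) - (k + 1) = N - k - 1 by ring, show (N : ℤ) + (k + 1) = N + k + 1 by ring, e1, e2]
    rcases lt_or_ge ((N : ℤ) - k) 0 with h | h
    · have : eQ Q ((N : ℤ) - k) = 0 := by unfold eQ; rw [if_pos h]
      rw [this]; simp
    · have hle : Q ^ ((N : ℤ) + k + 1) ≤ Q ^ ((N : ℤ) - k) :=
        zpow_le_zpow_right_of_le_one₀ h0 h1.le (by omega)
      have p1 := eQ_nonneg h0 h1 ((N : ℤ) - k)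
      have p2 := eQ_nonneg h0 h1 ((N : ℤ) + k + 1)
      nlinarith [mul_nonneg p1 p2]

lemma eQ_mul_le_int {Q : ℝ} (h0 : 0 < Q) (h1 : Q < 1) (N : ℕ) (k : ℤ) :
    eQ Q (N + k) * eQ Q (N - k) ≤ eQ Q N ^ 2 := by
  rcases Int.natAbs_eq k with h | h
  · rw [h]; exact eQ_mul_le h0 h1 N _
  · rw [h]
    have := eQ_mul_le h0 h1 N k.natAbs
    rw [sub_neg_eq_add, ← sub_eq_add_neg, mul_comm]; exact this

open Filter Topology in
lemma eQ_ratio_tendsto_add {Q : ℝ} (h0 : 0 < Q) (h1 : Q < 1) (k : ℕ) :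
    Tendsto (fun N : ℕ => eQ Q (N + k) / eQ Q N) atTop (𝓝 1) := by
  induction k with
  | zero =>
    refine tendsto_const_nhds.congr fun N => ?_
    have := (eQ_pos h0 h1 N).ne'
    simp [this]
  | succ k ih =>
    have l1 : Tendsto (fun N : ℕ => (1 - Q ^ (N + k + 1))⁻¹) atTop (𝓝 ((1 - 0)⁻¹)) := by
      refine Tendsto.inv₀ (tendsto_const_nhds.sub ?_) (by norm_num)
      have := (tendsto_pow_atTop_nhds_zero_of_lt_one h0.le h1)
      exact this.comp ((tendsto_add_atTop_iff_nat (f := fun n => n) (k + 1)).mpr tendsto_id)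
    have l2 := ih.mul l1
    simp only [sub_zero, inv_one, mul_one] at l2
    refine l2.congr fun N => ?_
    have e2 := eQ_pred h0 h1 ((N : ℤ) + k + 1)
    rw [show (N : ℤ) + k + 1 - 1 = N + k by ring] at e2
    push_cast
    rw [← add_assoc, e2]
    have e3 : Q ^ ((N : ℤ) + k + 1) = Q ^ (N + k + 1) := by
      rw [← zpow_natCast]; norm_num
    rw [e3]
    have := (one_sub_pow_pos h0 h1 (N + k)).ne'
    field_simp

open Filter Topology in
lemma eQ_ratio_tendsto_sub {Q : ℝ} (h0 : 0 < Q) (h1 : Q < 1) (k : ℕ) :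
    Tendsto (fun N : ℕ => eQ Q (N - k) / eQ Q N) atTop (𝓝 1) := by
  rw [← tendsto_add_atTop_iff_nat k]
  have := (eQ_ratio_tendsto_add h0 h1 k).inv₀ (by norm_num)
  rw [inv_one] at this
  refine this.congr fun N => ?_
  rw [inv_div]
  push_cast
  rw [add_sub_cancel_right]

open Filter Topology in
lemma PQ_tendsto {q : ℝ} (h0 : 0 < q) (h1 : q < 1) (φ : ℝ) :
    Tendsto (fun N : ℕ => PQ q N (cos φ) / (cQ (q ^ 2) N * eQ (q ^ 2) N ^ 2)) atTop
      (𝓝 (∑' k : ℤ, q ^ (k ^ 2) * cos (k * φ))) := by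
  have hQ0 : 0 < q ^ 2 := by positivity
  have hQ1 : q ^ 2 < 1 := pow_lt_one₀ h0.le h1 (by norm_num)
  have hrep : ∀ N : ℕ, PQ q N (cos φ) / (cQ (q ^ 2) N * eQ (q ^ 2) N ^ 2) =
      ∑' k : ℤ, q ^ (k ^ 2) * (eQ (q ^ 2) (N + k) * eQ (q ^ 2) (N - k) / eQ (q ^ 2) N ^ 2) * cos (k * φ) := by
    intro N
    have := ((hasSum_PQ h0 h1 φ N).div_const (cQ (q ^ 2) N * eQ (q ^ 2) N ^ 2)).tsum_eq
    rw [← this]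
    refine tsum_congr fun k => ?_
    have := (eQ_pos hQ0 hQ1 N).ne'
    have := (cQ_pos hQ0 hQ1 N).ne'
    unfold DQ
    field_simp
  simp_rw [hrep]
  refine tendsto_tsum_of_dominated_convergence (bound := fun k : ℤ => q ^ k.natAbs)
    (hasSum_geom_int h0.le h1).summable ?_ ?_
  · intro k
    have l : Tendsto (fun N : ℕ => eQ (q ^ 2) (N + k) * eQ (q ^ 2) (N - k) / eQ (q ^ 2) N ^ 2) atTop (𝓝 1) := by
      rcases Int.natAbs_eq k with h | h
      · rw [h]
        have := (eQ_ratio_tendsto_add hQ0 hQ1 k.natAbs).mul (eQ_ratio_tendsto_sub hQ0 hQ1 k.natAbs)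
        rw [mul_one] at this
        refine this.congr fun N => ?_
        rw [div_mul_div_comm, ← sq]
      · rw [h]
        have := (eQ_ratio_tendsto_sub hQ0 hQ1 k.natAbs).mul (eQ_ratio_tendsto_add hQ0 hQ1 k.natAbs)
        rw [mul_one] at this
        refine this.congr fun N => ?_
        rw [div_mul_div_comm, ← sq, sub_neg_eq_add, ← sub_eq_add_neg]
    have := (l.const_mul (q ^ (k ^ 2))).mul_const (cos (k * φ))
    rwa [mul_one] at this
  · refine Eventually.of_forall fun N k => ?_
    have hp := eQ_pos hQ0 hQ1 N
    have b1 : eQ (q ^ 2) (N + k) * eQ (q ^ 2) (N - k) / eQ (q ^ 2) N ^ 2 ≤ 1 := by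
      rw [div_le_one (by positivity)]; exact eQ_mul_le_int hQ0 hQ1 N k
    have b0 : 0 ≤ eQ (q ^ 2) (N + k) * eQ (q ^ 2) (N - k) / eQ (q ^ 2) N ^ 2 :=
      div_nonneg (mul_nonneg (eQ_nonneg hQ0 hQ1 _) (eQ_nonneg hQ0 hQ1 _)) (by positivity)
    have b2 : |cos (k * φ)| ≤ 1 := abs_cos_le_one _
    have b3 : q ^ (k ^ 2) ≤ q ^ k.natAbs := by
      rw [← zpow_natCast]
      refine zpow_le_zpow_right_of_le_one₀ h0 h1.le ?_
      rw [← Int.natAbs_sq]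
      exact_mod_cast Nat.le_self_pow (by norm_num) _
    have b4 : 0 < q ^ (k ^ 2) := by positivity
    rw [Real.norm_eq_abs, abs_mul, abs_mul, abs_of_pos b4, abs_of_nonneg b0]
    calc _ ≤ q ^ (k ^ 2) * 1 * 1 := by gcongr
      _ ≤ _ := by simpa using b3

/-- product inequality -/
lemma PQ_ineq {q : ℝ} (h0 : 0 < q) (h1 : q < 1) (N : ℕ) {d d' K : ℝ} (hd : 0 ≤ d)
    (hd' : 0 ≤ d') (hd2 : d' ≤ 2) (hK : d' ≤ K * d) (hK0 : 0 ≤ K) :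
    PQ q N (-1) * (PQ q N 1 - PQ q N (1 - d')) ≤ K * (PQ q N 1 * (PQ q N (-1 + d) - PQ q N (-1))) := by
  -- S = ∑ 2 q_r / (1 + q_r)^2
  have key : ∀ N, ∃ S : ℝ, 0 ≤ S ∧ PQ q N 1 * (1 - S * d') ≤ PQ q N (1 - d') ∧
      PQ q N (-1) * (1 + S * d) ≤ PQ q N (-1 + d) ∧ 0 < PQ q N 1 ∧ 0 < PQ q N (-1) ∧
      0 ≤ PQ q N (1 - d') ∧ PQ q N (1 - d') ≤ PQ q N 1 := by
    intro N
    induction N with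
    | zero => exact ⟨0, le_rfl, by simp [PQ]⟩
    | succ N ih =>
      obtain ⟨S, hS, i1, i2, i3, i4, i5, i6⟩ := ih
      set c := q ^ (2 * N + 1) with hc
      have c0 : 0 < c := by positivity
      have c1 : c < 1 := pow_lt_one₀ h0.le h1 (by omega)
      have step : ∀ s, PQ q (N + 1) s = PQ q N s * (1 + c ^ 2 + 2 * c * s) := fun s => by
        unfold PQ; rw [Finset.prod_range_succ]
      refine ⟨S + 2 * c / (1 + c) ^ 2, by positivity, ?_, ?_, ?_, ?_, ?_, ?_⟩
      · rw [step, step]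
        have e1 : (1 + c ^ 2 + 2 * c * (1 - d')) = (1 + c) ^ 2 * (1 - 2 * c / (1 + c) ^ 2 * d') := by
          field_simp; ring
        have e2 : (1 + c ^ 2 + 2 * c * 1) = (1 + c) ^ 2 := by ring
        rw [e1, e2]
        set y := 2 * c / (1 + c) ^ 2 with hy
        have y0 : 0 ≤ y := by positivity
        have y1 : y * d' ≤ 1 := by
          rw [hy, div_mul_eq_mul_div, div_le_one (by positivity)]
          nlinarith [sq_nonneg (1 - c)]
        have m1 : PQ q N 1 * (1 - S * d') * (1 - y * d') ≤ PQ q N (1 - d') * (1 - y * d') :=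
          mul_le_mul_of_nonneg_right i1 (by linarith)
        have m2 : 0 ≤ PQ q N 1 * ((S * d') * (y * d')) := by positivity
        have m3 : PQ q N 1 * (1 - (S + y) * d') ≤ PQ q N (1 - d') * (1 - y * d') := by
          nlinarith
        have m4 := mul_le_mul_of_nonneg_left m3 (sq_nonneg (1 + c))
        nlinarith
      · rw [step, step]
        have e2 : (1 + c ^ 2 + 2 * c * (-1)) = (1 - c) ^ 2 := by ring
        have e1 : (1 + c ^ 2 + 2 * c * (-1 + d)) = (1 - c) ^ 2 + 2 * c * d := by ring
        rw [e1, e2]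
        have y1 : (1 - c) ^ 2 * (2 * c / (1 + c) ^ 2 * d) ≤ 2 * c * d := by
          have : (1 - c) ^ 2 / (1 + c) ^ 2 ≤ 1 := by
            rw [div_le_one (by positivity)]; nlinarith
          calc (1 - c) ^ 2 * (2 * c / (1 + c) ^ 2 * d) = (1 - c) ^ 2 / (1 + c) ^ 2 * (2 * c * d) := by ring
            _ ≤ 1 * (2 * c * d) := by gcongr
            _ = _ := by ring
        have m1 : PQ q N (-1) * (1 + S * d) * ((1 - c) ^ 2 + 2 * c * d) ≤
          PQ q N (-1 + d) * ((1 - c) ^ 2 + 2 * c * d) := mul_le_mul_of_nonneg_right i2 (by positivity)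
        have m2 : 0 ≤ PQ q N (-1) * (S * d * (2 * c * d)) := by positivity
        have m3 := mul_le_mul_of_nonneg_left y1 i4.le
        nlinarith
      · rw [step]; positivity
      · rw [step]
        have e2 : (1 + c ^ 2 + 2 * c * (-1)) = (1 - c) ^ 2 := by ring
        rw [e2]
        have : 0 < 1 - c := by linarith
        positivity
      · rw [step]
        refine mul_nonneg i5 ?_
        nlinarith [sq_nonneg (1 - c)]
      · rw [step, step]
        refine mul_le_mul i6 ?_ ?_ i3.le
        · nlinarith
        · nlinarith [sq_nonneg (1 - c)]
  obtain ⟨S, hS, i1, i2, i3, i4, -, -⟩ := key N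
  have a1 : PQ q N 1 - PQ q N (1 - d') ≤ PQ q N 1 * (S * d') := by linarith
  have a2 : PQ q N (-1) * (S * d) ≤ PQ q N (-1 + d) - PQ q N (-1) := by linarith
  have a3 := mul_le_mul_of_nonneg_left a1 i4.le
  have a4 := mul_le_mul_of_nonneg_left (mul_le_mul_of_nonneg_left a2 i3.le) hK0
  have a5 : PQ q N (-1) * PQ q N 1 * S * d' ≤ PQ q N (-1) * PQ q N 1 * S * (K * d) :=
    mul_le_mul_of_nonneg_left hK (by positivity)
  linarith

lemma one_sub_cos_nat_mul (n : ℕ) (x : ℝ) : 1 - cos (n * x) ≤ (n : ℝ) ^ 2 * (1 - cos x) := by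
  have h : ∀ n : ℕ, |sin (n * (x / 2))| ≤ n * |sin (x / 2)| := by
    intro n
    induction n with
    | zero => simp
    | succ n ih =>
      push_cast
      rw [add_mul, one_mul, sin_add]
      calc _ ≤ |sin (n * (x / 2)) * cos (x / 2)| + |cos (n * (x / 2)) * sin (x / 2)| := abs_add_le _ _
        _ ≤ |sin (n * (x / 2))| * 1 + 1 * |sin (x / 2)| := by
          rw [abs_mul, abs_mul]
          gcongr <;> exact abs_cos_le_one _
        _ ≤ _ := by linarith
  have h1 : ∀ y : ℝ, 1 - cos y = 2 * sin (y / 2) ^ 2 := by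
    intro y
    have := Real.cos_sq' (y / 2)
    have h2 := Real.cos_two_mul (y / 2)
    rw [show 2 * (y / 2) = y by ring] at h2
    nlinarith
  rw [h1, h1]
  have h2 := h n
  have h3 := pow_le_pow_left₀ (abs_nonneg _) h2 2
  rw [mul_pow, sq_abs, sq_abs] at h3
  rw [show (n : ℝ) * x / 2 = n * (x / 2) by ring]
  linarith

/-- Key inequality for the one-dimensional theta function. -/
lemma Th_key {t : ℝ} (ht : 0 < t) (u : ℝ) (n : ℕ) :
    Th t (1 / 2) * (Th t 0 - Th t (n * u)) ≤ (n : ℝ) ^ 2 * (Th t 0 * (Th t (1 / 2 + u) - Th t (1 / 2))) := by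
  set q := exp (-π * t) with hq
  have h0 : 0 < q := exp_pos _
  have h1 : q < 1 := by rw [hq, Real.exp_lt_one_iff]; nlinarith [mul_pos pi_pos ht]
  have hT : ∀ β, Th t β = ∑' k : ℤ, q ^ (k ^ 2) * cos (k * (2 * π * β)) := by
    intro β
    unfold Th
    refine tsum_congr fun k => ?_
    have e : (k ^ 2 : ℤ) = ((k.natAbs ^ 2 : ℕ) : ℤ) := by rw [← Int.natAbs_sq]; push_cast; rfl
    have e' : ((k.natAbs ^ 2 : ℕ) : ℝ) = (k : ℝ) ^ 2 := by
      have := congrArg (fun z : ℤ => (z : ℝ)) e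
      push_cast at this ⊢
      simp
    rw [e, zpow_natCast, hq, ← Real.exp_nat_mul, e']
    congr 2
    · ring
    · ring
  have l1 := PQ_tendsto h0 h1 (2 * π * (1 / 2))
  have l2 := PQ_tendsto h0 h1 (2 * π * 0)
  have l3 := PQ_tendsto h0 h1 (2 * π * (n * u))
  have l4 := PQ_tendsto h0 h1 (2 * π * (1 / 2 + u))
  rw [← hT] at l1 l2 l3 l4
  refine le_of_tendsto_of_tendsto' (l1.mul (l2.sub l3)) ((l2.mul (l4.sub l1)).const_mul ((n : ℝ) ^ 2)) ?_
  intro N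
  have c1 : cos (2 * π * (1 / 2)) = -1 := by rw [show 2 * π * (1 / 2) = π by ring, cos_pi]
  have c2 : cos (2 * π * 0) = 1 := by simp
  have c4 : cos (2 * π * (1 / 2 + u)) = -1 + (1 - cos (2 * π * u)) := by
    rw [show 2 * π * (1 / 2 + u) = 2 * π * u + π by ring, cos_add_pi]; ring
  have c3 : cos (2 * π * (n * u)) = 1 - (1 - cos (n * (2 * π * u))) := by
    rw [show 2 * π * (n * u) = n * (2 * π * u) by ring]; ring
  rw [c1, c2, c3, c4]
  have := PQ_ineq h0 h1 N (d := 1 - cos (2 * π * u)) (d' := 1 - cos (n * (2 * π * u))) (K := (n : ℝ) ^ 2)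
    (by linarith [cos_le_one (2 * π * u)]) (by linarith [cos_le_one (n * (2 * π * u))])
    (by linarith [neg_one_le_cos (n * (2 * π * u))]) (one_sub_cos_nat_mul n _) (by positivity)
  set C := cQ (q ^ 2) N * eQ (q ^ 2) N ^ 2
  have e : ∀ a b c : ℝ, a / C * (b / C - c / C) = a * (b - c) / (C * C) := by
    intro a b c; rw [← sub_div, div_mul_div_comm]
  rw [e, e, ← mul_div_assoc]
  exact div_le_div_of_nonneg_right this (mul_self_nonneg _)

/-- The two-dimensional theta function at `z = x + i y`. -/
noncomputable def TT (α x y : ℝ) : ℝ :=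
  ∑' p : ℤ × ℤ, exp (-π * α * (((p.2 : ℝ) + p.1 * x) ^ 2 / y + (p.1 : ℝ) ^ 2 * y))

lemma summable_gauss2 {c : ℝ} (hc : 0 < c) :
    Summable (fun p : ℤ × ℤ => exp (-c * ((p.1 : ℝ) ^ 2 + (p.2 : ℝ) ^ 2))) := by
  have h := (summable_gauss hc).mul_of_nonneg (summable_gauss hc) (fun _ => (exp_pos _).le)
    (fun _ => (exp_pos _).le)
  refine h.congr fun p => ?_
  rw [← Real.exp_add]; ring_nf

lemma form_lower {x y : ℝ} (hy : 0 < y) (m n : ℝ) :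
    y / (1 + x ^ 2 + y ^ 2) * (n ^ 2 + m ^ 2) ≤ (m + n * x) ^ 2 / y + n ^ 2 * y := by
  have hτ : 0 < 1 + x ^ 2 + y ^ 2 := by positivity
  rw [div_mul_eq_mul_div, div_le_iff₀ hτ]
  have : ((m + n * x) ^ 2 / y + n ^ 2 * y) * (1 + x ^ 2 + y ^ 2) - y * (n ^ 2 + m ^ 2)
     = y * ((m / y + n * x / y) ^ 2 + (m * x / y + n * (x ^ 2 + y ^ 2) / y) ^ 2) := by
    field_simp; ring
  have h2 : 0 ≤ y * ((m / y + n * x / y) ^ 2 + (m * x / y + n * (x ^ 2 + y ^ 2) / y) ^ 2) := by positivity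
  linarith

lemma summable_form {a x y : ℝ} (ha : 0 < a) (hy : 0 < y) :
    Summable (fun p : ℤ × ℤ => exp (-a * (((p.2 : ℝ) + p.1 * x) ^ 2 / y + (p.1 : ℝ) ^ 2 * y))) := by
  have hc : 0 < a * (y / (1 + x ^ 2 + y ^ 2)) := by positivity
  refine Summable.of_nonneg_of_le (fun _ => (exp_pos _).le) (fun p => ?_) (summable_gauss2 hc)
  apply Real.exp_le_exp.mpr
  have := mul_le_mul_of_nonneg_left (form_lower (x := x) hy (p.2 : ℝ) (p.1 : ℝ)) ha.le
  linarith

lemma TT_rows {α x y : ℝ} (hα : 0 < α) (hy : 0 < y) :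
    TT α x y = √(y / α) * ∑' n : ℤ, exp (-π * α * y * (n : ℝ) ^ 2) * Th (y / α) (n * x) ∧
    Summable (fun n : ℤ => exp (-π * α * y * (n : ℝ) ^ 2) * Th (y / α) (n * x)) := by
  have hs : Summable (fun p : ℤ × ℤ => exp (-π * α * (((p.2 : ℝ) + p.1 * x) ^ 2 / y + (p.1 : ℝ) ^ 2 * y))) := by
    have := summable_form (a := π * α) (x := x) (by positivity) hy
    refine this.congr fun p => ?_
    ring_nf
  have hrow : ∀ n : ℤ, ∑' m : ℤ, exp (-π * α * (((m : ℝ) + n * x) ^ 2 / y + (n : ℝ) ^ 2 * y))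
      = √(y / α) * (exp (-π * α * y * (n : ℝ) ^ 2) * Th (y / α) (n * x)) := by
    intro n
    have h := poisson (s := α / y) (by positivity) (n * x)
    rw [one_div_div] at h
    rw [mul_left_comm, ← h, ← tsum_mul_left]
    refine tsum_congr fun m => ?_
    rw [← Real.exp_add]
    congr 1
    field_simp; ring
  constructor
  · unfold TT
    rw [hs.tsum_prod, ← tsum_mul_left]
    exact tsum_congr hrow
  · have h2 := hs.prod
    simp_rw [hrow] at h2
    have hne : √(y / α) ≠ 0 := by positivity
    exact (summable_mul_left_iff hne).mp h2

lemma TT_functional {α x y : ℝ} (hα : 0 < α) (hy : 0 < y) : TT (1 / α) x y = α * TT α x y := by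
  have key : ∀ α : ℝ, 0 < α → TT α x y = √(y / α) * ∑' p : ℤ × ℤ,
      exp (-π * y * (α * (p.1 : ℝ) ^ 2 + (1 / α) * (p.2 : ℝ) ^ 2)) * cos (2 * π * p.1 * p.2 * x) := by
    intro α hα
    rw [(TT_rows hα hy).1]
    congr 1
    have hs : Summable (fun p : ℤ × ℤ => exp (-π * y * (α * (p.1 : ℝ) ^ 2 + (1 / α) * (p.2 : ℝ) ^ 2))
        * cos (2 * π * p.1 * p.2 * x)) := by
      have h := (summable_gauss (c := π * y * α) (by positivity)).mul_of_nonneg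
        (summable_gauss (c := π * y * (1 / α)) (by positivity)) (fun _ => (exp_pos _).le)
        (fun _ => (exp_pos _).le)
      refine Summable.of_norm_bounded h fun p => ?_
      rw [norm_mul, Real.norm_of_nonneg (exp_pos _).le, ← Real.exp_add]
      calc _ ≤ exp (-π * y * (α * (p.1 : ℝ) ^ 2 + (1 / α) * (p.2 : ℝ) ^ 2)) * 1 := by
            gcongr; exact abs_cos_le_one _
        _ ≤ _ := by rw [mul_one]; apply Real.exp_le_exp.mpr; apply le_of_eq; ring
    rw [hs.tsum_prod]
    refine tsum_congr fun n => ?_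
    unfold Th
    rw [← tsum_mul_left]
    refine tsum_congr fun k => ?_
    rw [← mul_assoc, ← Real.exp_add]
    congr 2
    · field_simp; ring
    · ring
  rw [key α hα, key (1 / α) (by positivity)]
  rw [← (Equiv.prodComm ℤ ℤ).tsum_eq]
  have e1 : √(y / (1 / α)) = α * √(y / α) := by
    rw [Real.sqrt_eq_iff_mul_self_eq (by positivity) (by positivity)]
    have := Real.mul_self_sqrt (show 0 ≤ y / α by positivity)
    have h2 : α * √(y / α) * (α * √(y / α)) = α * α * (√(y / α) * √(y / α)) := by ring
    rw [h2, this]; field_simp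
  rw [e1, mul_assoc]
  congr 2
  refine tsum_congr fun p => ?_
  simp only [Equiv.prodComm_apply, Prod.fst_swap, Prod.snd_swap, one_div_one_div]
  congr 2 <;> ring

lemma exp_neg_pi_le : exp (-π) ≤ 1 / 20 := by
  have h1 : exp (-π) ≤ exp (-3) := Real.exp_le_exp.mpr (by linarith [pi_gt_three])
  have h2 : exp (-3) ≤ 1 / 20 := by
    rw [Real.exp_neg, inv_eq_one_div]
    apply one_div_le_one_div_of_le (by norm_num)
    have : exp 3 = exp 1 ^ 3 := by rw [← Real.exp_nat_mul]; norm_num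
    rw [this]
    have := Real.exp_one_gt_d9
    calc (20 : ℝ) ≤ 2.718 ^ 3 := by norm_num
      _ ≤ _ := by gcongr; linarith
  linarith

lemma gauss_sum_le {c : ℝ} (hc : π ≤ c) : ∑' k : ℤ, exp (-c * (k : ℝ) ^ 2) ≤ 10 / 9 := by
  have hc0 : 0 < c := lt_of_lt_of_le pi_pos hc
  have hr : exp (-c) ≤ 1 / 20 := le_trans (Real.exp_le_exp.mpr (by linarith)) exp_neg_pi_le
  have hg := hasSum_geom_int (r := 1 / 20) (by norm_num) (by norm_num)
  refine le_trans (Summable.tsum_le_tsum (g := fun k : ℤ => (1 / 20 : ℝ) ^ k.natAbs) (fun k => ?_)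
    (summable_gauss hc0) hg.summable) ?_
  · refine le_trans (exp_sq_le_geom hc0 k) ?_
    gcongr
  · rw [hg.tsum_eq]; norm_num

lemma Th_zero_eq (t : ℝ) : Th t 0 = ∑' k : ℤ, exp (-(π * t) * (k : ℝ) ^ 2) := by
  unfold Th
  refine tsum_congr fun k => ?_
  simp

lemma Th_le_zero {t : ℝ} (ht : 0 < t) (β : ℝ) : Th t β ≤ Th t 0 := by
  unfold Th
  refine Summable.tsum_le_tsum (fun k => ?_) (summable_Th ht β) (summable_Th ht 0)
  have := exp_pos (-π * t * (k : ℝ) ^ 2)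
  simp only [mul_zero, cos_zero]
  gcongr
  exact cos_le_one _

lemma Th_zero_ge {t : ℝ} (ht : 0 < t) : 1 ≤ Th t 0 := by
  rw [Th_zero_eq]
  have h := (summable_gauss (c := π * t) (by positivity)).le_tsum 0 (fun _ _ => (exp_pos _).le)
  simpa using h

/-- Lower bound for `θ₄/θ₃`. -/
lemma Th_ratio {t : ℝ} (ht : 0 < t) :
    4 / 5 * exp (-π / (4 * t)) * Th t 0 ≤ Th t (1 / 2) := by
  rcases le_or_gt 1 t with h | h
  · have h1 : Th t 0 ≤ 10 / 9 := by
      rw [Th_zero_eq]; exact gauss_sum_le (by nlinarith [pi_pos])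
    have h2 : 2 - Th t 0 ≤ Th t (1 / 2) := by
      have hs := hasSum_ite_eq (0 : ℤ) (2 : ℝ)
      have := hs.sub (summable_Th ht 0).hasSum
      change HasSum _ (2 - Th t 0) at this
      rw [← this.tsum_eq]
      unfold Th
      refine Summable.tsum_le_tsum (fun k => ?_) this.summable (summable_Th ht _)
      have hp := exp_pos (-π * t * (k : ℝ) ^ 2)
      by_cases hk : k = 0
      · subst hk; norm_num
      · simp only [hk, if_false]
        have := neg_one_le_cos (2 * π * k * (1 / 2))
        simp only [mul_zero, cos_zero]
        nlinarith
    have h3 : exp (-π / (4 * t)) ≤ 1 := by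
      rw [Real.exp_le_one_iff, neg_div]
      have : 0 < π / (4 * t) := by positivity
      linarith
    have h4 := Th_zero_ge ht
    have h5 : exp (-π / (4 * t)) * Th t 0 ≤ 1 * Th t 0 := by gcongr
    linarith
  · have p0 := poisson (s := 1 / t) (by positivity) 0
    have p1 := poisson (s := 1 / t) (by positivity) (1 / 2)
    rw [one_div_one_div] at p0 p1
    have hst : 0 < √t := by positivity
    have h0 : √t * Th t 0 ≤ 10 / 9 := by
      rw [← p0]
      refine le_trans (le_of_eq ?_) (gauss_sum_le (c := π * (1 / t)) ?_)
      · refine tsum_congr fun m => ?_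
        congr 1; ring
      · have : 1 ≤ 1 / t := by rw [le_div_iff₀ ht]; linarith
        nlinarith [pi_pos]
    have h1 : 2 * exp (-π / (4 * t)) ≤ √t * Th t (1 / 2) := by
      rw [← p1]
      have hs := summable_shift (s := 1 / t) (by positivity) (1 / 2)
      have := hs.sum_le_tsum {0, -1} (fun _ _ => (exp_pos _).le)
      rw [Finset.sum_pair (by norm_num)] at this
      refine le_trans (le_of_eq ?_) this
      rw [two_mul]
      push_cast
      congr 2
      · field_simp; norm_num
      · field_simp; norm_num
    have h2 : 0 < exp (-π / (4 * t)) := exp_pos _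
    have h3 : √t * (4 / 5 * exp (-π / (4 * t)) * Th t 0) ≤ √t * Th t (1 / 2) := by
      calc √t * (4 / 5 * exp (-π / (4 * t)) * Th t 0) = 4 / 5 * exp (-π / (4 * t)) * (√t * Th t 0) := by ring
        _ ≤ 4 / 5 * exp (-π / (4 * t)) * (10 / 9) := by gcongr
        _ ≤ _ := by linarith
    exact le_of_mul_le_mul_left h3 hst

lemma Th_half_pos {t : ℝ} (ht : 0 < t) : 0 < Th t (1 / 2) := by
  refine lt_of_lt_of_le ?_ (Th_ratio ht)
  have := Th_zero_ge ht
  have := exp_pos (-π / (4 * t))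
  positivity

lemma Th_half_le {t : ℝ} (ht : 0 < t) (u : ℝ) : 0 ≤ Th t (1 / 2 + u) - Th t (1 / 2) := by
  have h := Th_key ht u 1
  have h1 := Th_half_pos ht
  have h2 := Th_zero_ge ht
  have h3 := Th_le_zero ht ((1 : ℕ) * u)
  have h4 : 0 ≤ Th t 0 * (Th t (1 / 2 + u) - Th t (1 / 2)) := by
    refine le_trans (mul_nonneg h1.le (sub_nonneg.mpr h3)) ?_
    simpa using h
  by_contra hcon
  push Not at hcon
  nlinarith

lemma Th_lt_zero {t : ℝ} (ht : 0 < t) {u : ℝ} (h0 : 0 < u) (h1 : u < 1) : Th t u < Th t 0 := by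
  unfold Th
  refine Summable.tsum_lt_tsum (i := 1) (fun k => ?_) ?_ (summable_Th ht u) (summable_Th ht 0)
  · have := exp_pos (-π * t * (k : ℝ) ^ 2)
    simp only [mul_zero, cos_zero]
    gcongr
    exact cos_le_one _
  · have := exp_pos (-π * t * ((1 : ℤ) : ℝ) ^ 2)
    simp only [mul_zero, cos_zero]
    gcongr
    refine lt_of_le_of_ne (cos_le_one _) ?_
    intro hc
    have := (Real.cos_eq_one_iff_of_lt_of_lt (x := 2 * π * ((1 : ℤ) : ℝ) * u) ?_ ?_).mp hc
    · have h3 : 0 < 2 * π * ((1 : ℤ) : ℝ) * u := by push_cast; positivity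
      linarith
    · push_cast; nlinarith [pi_pos, mul_pos pi_pos h0]
    · push_cast; nlinarith [pi_pos, mul_pos pi_pos h0]

lemma Th_half_lt {t : ℝ} (ht : 0 < t) {u : ℝ} (h0 : 0 < u) (h1 : u < 1) :
    0 < Th t (1 / 2 + u) - Th t (1 / 2) := by
  have h := Th_key ht u 1
  have hh := Th_half_pos ht
  have h2 := Th_zero_ge ht
  have h3 := Th_lt_zero ht h0 h1
  have h4 : 0 < Th t 0 * (Th t (1 / 2 + u) - Th t (1 / 2)) := by
    refine lt_of_lt_of_le (mul_pos hh (sub_pos.mpr h3)) ?_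
    simpa using h
  by_contra hcon
  push Not at hcon
  nlinarith

lemma Th_neg (t β : ℝ) : Th t (-β) = Th t β := by
  unfold Th
  refine tsum_congr fun k => ?_
  rw [mul_neg, cos_neg]

lemma Th_add_int (t β : ℝ) (j : ℤ) : Th t (β + j) = Th t β := by
  unfold Th
  refine tsum_congr fun k => ?_
  have : 2 * π * k * (β + j) = 2 * π * k * β + ((k * j : ℤ) : ℝ) * (2 * π) := by push_cast; ring
  rw [this, cos_add_int_mul_two_pi]

lemma Th_sub_nonneg_odd {t : ℝ} (ht : 0 < t) (n : ℤ) (hn : Odd n) (x : ℝ) :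
    0 ≤ Th t (n * x) - Th t (n * (1 / 2)) := by
  obtain ⟨j, rfl⟩ := hn
  have e : (((2 * j + 1 : ℤ) : ℝ) * (1 / 2)) = 1 / 2 + j := by push_cast; ring
  rw [e, Th_add_int]
  have := Th_half_le ht (((2 * j + 1 : ℤ) : ℝ) * x - 1 / 2)
  rwa [add_sub_cancel] at this

/-- elementary estimate -/
lemma even_term_bound {c : ℝ} (hc : 5 / 2 ≤ c) (n : ℤ) (hn : Even n) :
    (n : ℝ) ^ 2 * exp (-c * ((n : ℝ) ^ 2 - 4 / 3)) ≤ 1 / 2 * (1 / 2) ^ n.natAbs := by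
  by_cases h0 : n = 0
  · subst h0; norm_num
  have h2 : 2 ≤ n.natAbs := by
    obtain ⟨j, hj⟩ := hn; omega
  have e : (n : ℝ) ^ 2 = (n.natAbs : ℝ) ^ 2 := by
    have := congrArg (fun z : ℤ => (z : ℝ)) (Int.natAbs_sq n)
    push_cast at this
    rw [← this]; simp
  rw [e]
  set m : ℝ := (n.natAbs : ℝ) with hm
  have hm2 : (2 : ℝ) ≤ m := by rw [hm]; exact_mod_cast h2
  have b1 : -c * (m ^ 2 - 4 / 3) ≤ -(10 / 3) * m := by
    have q : 4 / 3 * m ≤ m ^ 2 - 4 / 3 := by nlinarith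
    have q2 : 5 / 2 * (m ^ 2 - 4 / 3) ≤ c * (m ^ 2 - 4 / 3) :=
      mul_le_mul_of_nonneg_right hc (by linarith)
    linarith
  have b2 : m ^ 2 ≤ 2 * exp m := by
    have := Real.quadratic_le_exp_of_nonneg (x := m) (by linarith)
    nlinarith
  have b3 : (1 / 2 : ℝ) ^ n.natAbs = exp (-(Real.log 2) * m) := by
    rw [mul_comm, hm, Real.exp_nat_mul, Real.exp_neg, Real.exp_log (by norm_num)]; norm_num
  have b4 : (1 : ℝ) / 4 ≥ exp (- 3 / 2) := by
    have h1 : exp (-3 / 2) ^ 2 ≤ (1 / 4) ^ 2 := by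
      rw [← Real.exp_nat_mul]
      have : exp ((2 : ℕ) * (-3 / 2)) = exp (-3) := by norm_num
      rw [this, Real.exp_neg, inv_eq_one_div]
      have : exp 3 = exp 1 ^ 3 := by rw [← Real.exp_nat_mul]; norm_num
      rw [this]
      have := Real.exp_one_gt_d9
      have h3 : (16 : ℝ) ≤ exp 1 ^ 3 := by
        calc (16 : ℝ) ≤ 2.718 ^ 3 := by norm_num
          _ ≤ _ := by gcongr; linarith
      calc 1 / exp 1 ^ 3 ≤ 1 / 16 := one_div_le_one_div_of_le (by norm_num) h3
        _ = _ := by norm_num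
    exact le_of_sq_le_sq h1 (by norm_num)
  rw [b3]
  calc m ^ 2 * exp (-c * (m ^ 2 - 4 / 3)) ≤ (2 * exp m) * exp (-(10 / 3) * m) := by
        gcongr
    _ = 2 * exp (-(7 / 3) * m) := by rw [mul_assoc, ← Real.exp_add]; ring_nf
    _ ≤ 2 * (exp (-3 / 2) * exp (-Real.log 2 * m)) := by
        rw [← Real.exp_add]
        have := Real.log_two_lt_d9
        gcongr
        nlinarith
    _ ≤ 2 * (1 / 4 * exp (-Real.log 2 * m)) := by gcongr
    _ = _ := by ring

/-- Monotonicity step in `x`. -/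
lemma TT_step_x {α x y : ℝ} (hα : 1 ≤ α) (hy : 0 < y) (hy2 : 3 ≤ 4 * y ^ 2) (hx0 : 0 ≤ x) (hx : x < 1 / 2) :
    TT α (1 / 2) y < TT α x y := by
  have hα0 : 0 < α := by linarith
  set t := y / α with ht_def
  have ht : 0 < t := by positivity
  obtain ⟨r1, s1⟩ := TT_rows (x := x) hα0 hy
  obtain ⟨r2, s2⟩ := TT_rows (x := 1 / 2) hα0 hy
  rw [r1, r2]
  have hsq : 0 < √(y / α) := by positivity
  refine mul_lt_mul_of_pos_left ?_ hsq
  rw [← sub_pos, ← s1.tsum_sub s2]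
  set Δ := Th t (1 / 2 + (1 / 2 - x)) - Th t (1 / 2) with hΔ
  have hΔ0 : 0 < Δ := Th_half_lt ht (by linarith) (by linarith)
  set b := π * α * y with hb
  have hy3 : 17 / 20 ≤ y := by nlinarith
  have hb1 : 5 / 2 ≤ b := by
    have h1 : 3 ≤ π * α := by nlinarith [pi_gt_three]
    rw [hb]; nlinarith
  have hg := hasSum_geom_int (r := 1 / 2) (by norm_num) (by norm_num)
  have hone : HasSum (fun n : ℤ => if n = 1 ∨ n = -1 then (1 : ℝ) else 0) 2 := by
    have : HasSum (fun n : ℤ => if n = 1 ∨ n = -1 then (1 : ℝ) else 0)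
        (∑ n ∈ ({1, -1} : Finset ℤ), if n = 1 ∨ n = -1 then (1 : ℝ) else 0) :=
      hasSum_sum_of_ne_finset_zero (by intro n hn; simp at hn; simp [hn])
    rw [Finset.sum_pair (by norm_num)] at this
    norm_num at this
    convert this using 1
  have hL := ((hone.sub (hg.mul_left (5 / 8))).mul_left (exp (-b) * Δ))
  have hLpos : 0 < exp (-b) * Δ * (2 - 5 / 8 * ((1 + 1 / 2) / (1 - 1 / 2))) := by
    have := exp_pos (-b)
    norm_num
    positivity
  refine lt_of_lt_of_le hLpos ?_
  rw [← hL.tsum_eq]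
  refine Summable.tsum_le_tsum (fun n => ?_) hL.summable (s1.sub s2)
  rw [← mul_sub]
  have hE : exp (-π * α * y * (n : ℝ) ^ 2) = exp (-b * (n : ℝ) ^ 2) := by rw [hb]; congr 1; ring
  rw [hE]
  have hpw : (0 : ℝ) < (1 / 2) ^ n.natAbs := by positivity
  have hEb := exp_pos (-b)
  have hEn := exp_pos (-b * (n : ℝ) ^ 2)
  by_cases h1 : n = 1 ∨ n = -1
  · have hd : Th t (n * x) - Th t (n * (1 / 2)) = Δ := by
      have hx1 : Th t (1 / 2 + (1 / 2 - x)) = Th t x := by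
        have := Th_add_int t (-x) 1
        rw [Th_neg] at this
        rw [← this]; congr 1; push_cast; ring
      rw [hΔ, hx1]
      rcases h1 with rfl | rfl
      · simp
      · push_cast; rw [neg_one_mul, neg_one_mul, Th_neg, Th_neg]
    have hn2 : (n : ℝ) ^ 2 = 1 := by rcases h1 with rfl | rfl <;> norm_num
    rw [hd, hn2, mul_one, if_pos h1]
    have : 0 < exp (-b) * Δ := by positivity
    nlinarith
  · rw [if_neg h1]
    rcases Int.even_or_odd n with hn | hn
    · -- even case
      have hk := Th_key ht (1 / 2 - x) n.natAbs
      have e : ((n.natAbs : ℝ)) ^ 2 = (n : ℝ) ^ 2 := by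
        have := congrArg (fun z : ℤ => (z : ℝ)) (Int.natAbs_sq n)
        push_cast at this
        rw [← this]; simp
      have e1 : Th t (n * (1 / 2)) = Th t 0 := by
        obtain ⟨j, rfl⟩ := hn
        have := Th_add_int t 0 j
        rw [← this]; congr 1; push_cast; ring
      have e2 : Th t (n.natAbs * (1 / 2 - x)) = Th t (n * x) := by
        have e3 : Th t (n.natAbs * (1 / 2 - x)) = Th t (n * (1 / 2 - x)) := by
          rcases Int.natAbs_eq n with h | h
          · have h' : (n : ℝ) = (n.natAbs : ℝ) := by
              have := congrArg (fun z : ℤ => (z : ℝ)) h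
              simpa only [Int.cast_natCast] using this
            rw [h']
          · have h' : (n : ℝ) = -(n.natAbs : ℝ) := by
              have := congrArg (fun z : ℤ => (z : ℝ)) h
              simpa only [Int.cast_natCast, Int.cast_neg] using this
            rw [h', neg_mul, Th_neg]
        rw [e3]
        obtain ⟨j, rfl⟩ := hn
        have := Th_add_int t (-(((j + j : ℤ) : ℝ) * x)) j
        rw [Th_neg] at this
        rw [← this]; congr 1; push_cast; ring
      rw [e, e2, ← hΔ] at hk
      rw [e1]
      have hr := Th_ratio ht
      have hz := Th_zero_ge ht
      have hw := Th_le_zero ht (n * x)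
      set W := Th t 0 - Th t (n * x) with hW
      have hW0 : 0 ≤ W := by linarith
      set ρ := exp (-π / (4 * t)) with hρ
      have hρ0 : 0 < ρ := exp_pos _
      have k1 : 4 / 5 * ρ * W ≤ (n : ℝ) ^ 2 * Δ := by
        have : Th t 0 * (4 / 5 * ρ * W) ≤ Th t 0 * ((n : ℝ) ^ 2 * Δ) := by
          have := mul_le_mul_of_nonneg_right hr hW0
          nlinarith
        exact le_of_mul_le_mul_left this (by linarith)
      have hρb : exp (-(b / 3)) ≤ ρ := by
        rw [hρ]
        apply Real.exp_le_exp.mpr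
        rw [neg_div, neg_le_neg_iff, hb, ht_def]
        rw [div_le_iff₀ (by positivity)]
        have : π * α * y / 3 * (4 * (y / α)) = π * (4 * y ^ 2) / 3 := by field_simp
        rw [this]
        nlinarith [pi_pos]
      have k2 : exp (-(b / 3)) * W ≤ 5 / 4 * ((n : ℝ) ^ 2 * Δ) := by
        have := mul_le_mul_of_nonneg_right hρb hW0
        linarith
      have k3 := even_term_bound hb1 n hn
      have k4 : exp (-b * (n : ℝ) ^ 2) * W ≤ exp (-b) * (5 / 4 * Δ * (1 / 2 * (1 / 2) ^ n.natAbs)) := by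
        have e5 : exp (-b * (n : ℝ) ^ 2) = exp (-b) * exp (-b * ((n : ℝ) ^ 2 - 4 / 3)) * exp (-(b / 3)) := by
          rw [← Real.exp_add, ← Real.exp_add]; congr 1; ring
        rw [e5]
        have hp := exp_pos (-b * ((n : ℝ) ^ 2 - 4 / 3))
        calc _ = exp (-b) * exp (-b * ((n : ℝ) ^ 2 - 4 / 3)) * (exp (-(b / 3)) * W) := by ring
          _ ≤ exp (-b) * exp (-b * ((n : ℝ) ^ 2 - 4 / 3)) * (5 / 4 * ((n : ℝ) ^ 2 * Δ)) := by gcongr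
          _ = exp (-b) * (5 / 4 * Δ * ((n : ℝ) ^ 2 * exp (-b * ((n : ℝ) ^ 2 - 4 / 3)))) := by ring
          _ ≤ _ := by gcongr
      have : Th t (n * x) - Th t 0 = -W := by rw [hW]; ring
      rw [this]
      linarith
    · have h5 := Th_sub_nonneg_odd ht n hn x
      have h6 := mul_nonneg hEn.le h5
      refine le_trans ?_ h6
      have : 0 < exp (-b) * Δ * (5 / 8 * (1 / 2) ^ n.natAbs) := by positivity
      linarith

/-- One term of the theta series along the line `x = 1/2`, as a function of `v = 1/y`. -/
noncomputable def ph (a A B v : ℝ) : ℝ := exp (-a * (A * v + B / v))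

noncomputable def ph1 (a A B v : ℝ) : ℝ := -a * (A - B / v ^ 2) * ph a A B v

noncomputable def ph2 (a A B v : ℝ) : ℝ :=
  (a ^ 2 * (A - B / v ^ 2) ^ 2 - 2 * a * B / v ^ 3) * ph a A B v

lemma hasDerivAt_div_ph (B : ℝ) {v : ℝ} (hv : 0 < v) :
    HasDerivAt (fun v : ℝ => B / v) (-(B / v ^ 2)) v := by
  have h : HasDerivAt (fun v : ℝ => B * v⁻¹) (B * (-(v ^ 2)⁻¹)) v :=
    (hasDerivAt_inv hv.ne').const_mul B
  have e : (fun v : ℝ => B / v) = fun v : ℝ => B * v⁻¹ := by funext v; rw [div_eq_mul_inv]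
  rw [e]
  exact h.congr_deriv (by rw [div_eq_mul_inv]; ring)

lemma hasDerivAt_div_sq_ph (B : ℝ) {v : ℝ} (hv : 0 < v) :
    HasDerivAt (fun v : ℝ => B / v ^ 2) (-(2 * B / v ^ 3)) v := by
  have h0 : HasDerivAt (fun v : ℝ => v ^ 2) (2 * v) v := by
    simpa using hasDerivAt_pow 2 v
  have h : HasDerivAt (fun v : ℝ => B * (v ^ 2)⁻¹) (B * (-(2 * v) / (v ^ 2) ^ 2)) v :=
    (h0.inv (by positivity)).const_mul B
  have e : (fun v : ℝ => B / v ^ 2) = fun v : ℝ => B * (v ^ 2)⁻¹ := by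
    funext v; rw [div_eq_mul_inv]
  rw [e]
  exact h.congr_deriv (by field_simp)

lemma hasDerivAt_ph (a A B : ℝ) {v : ℝ} (hv : 0 < v) : HasDerivAt (ph a A B) (ph1 a A B v) v := by
  have h1 : HasDerivAt (fun v : ℝ => -a * (A * v + B / v)) (-a * (A * 1 + -(B / v ^ 2))) v :=
    HasDerivAt.const_mul (-a) (HasDerivAt.add ((hasDerivAt_id v).const_mul A)
      (hasDerivAt_div_ph B hv))
  have h2 : HasDerivAt (ph a A B) _ v := h1.exp
  refine h2.congr_deriv ?_
  unfold ph1 ph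
  ring

lemma hasDerivAt_ph1 (a A B : ℝ) {v : ℝ} (hv : 0 < v) :
    HasDerivAt (ph1 a A B) (ph2 a A B v) v := by
  have h1 : HasDerivAt (fun v : ℝ => -a * (A - B / v ^ 2)) (-a * (-(-(2 * B / v ^ 3)))) v :=
    HasDerivAt.const_mul (-a) ((hasDerivAt_div_sq_ph B hv).const_sub A)
  have h2 : HasDerivAt (ph1 a A B) _ v := h1.mul (hasDerivAt_ph a A B hv)
  refine h2.congr_deriv ?_
  unfold ph2 ph1
  ring

lemma ph_taylor {a A B v v0 c : ℝ} (hv : 0 < v) (hvv : v < v0)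
    (hc : ∀ u, 0 < u → u ≤ v0 → -c ≤ ph2 a A B u) :
    ph a A B v0 + ph1 a A B v0 * (v - v0) - c / 2 * (v - v0) ^ 2 ≤ ph a A B v := by
  have hg : ∀ u, 0 < u → HasDerivAt (fun u => ph a A B u + c / 2 * (u - v0) ^ 2)
      (ph1 a A B u + c * (u - v0)) u := by
    intro u hu
    have h0 : HasDerivAt (fun u : ℝ => c / 2 * (u - v0) ^ 2) _ u :=
      ((((hasDerivAt_id u).sub_const v0).pow 2).const_mul (c / 2))
    have h : HasDerivAt (fun u => ph a A B u + c / 2 * (u - v0) ^ 2) _ u :=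
      (hasDerivAt_ph a A B hu).add h0
    refine h.congr_deriv ?_
    norm_num
    ring
  have hg1 : ∀ u, 0 < u → HasDerivAt (fun u => ph1 a A B u + c * (u - v0)) (ph2 a A B u + c) u := by
    intro u hu
    have h0 : HasDerivAt (fun u : ℝ => c * (u - v0)) _ u :=
      ((hasDerivAt_id u).sub_const v0).const_mul c
    have h : HasDerivAt (fun u => ph1 a A B u + c * (u - v0)) _ u :=
      (hasDerivAt_ph1 a A B hu).add h0
    exact h.congr_deriv (by norm_num)
  obtain ⟨ξ, ⟨h1, h2⟩, h3⟩ := exists_hasDerivAt_eq_slope (fun u => ph a A B u + c / 2 * (u - v0) ^ 2)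
    (fun u => ph1 a A B u + c * (u - v0)) hvv
    (fun u hu => (hg u (lt_of_lt_of_le hv hu.1)).continuousAt.continuousWithinAt)
    (fun u hu => hg u (lt_trans hv hu.1))
  obtain ⟨η, ⟨k1, k2⟩, k3⟩ := exists_hasDerivAt_eq_slope (fun u => ph1 a A B u + c * (u - v0))
    (fun u => ph2 a A B u + c) h2
    (fun u hu => (hg1 u (lt_of_lt_of_le (hv.trans h1) hu.1)).continuousAt.continuousWithinAt)
    (fun u hu => hg1 u (lt_trans (hv.trans h1) hu.1))
  have h4 := hc η (hv.trans (h1.trans k1)) k2.le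
  rw [eq_div_iff (by linarith)] at h3 k3
  have h5 : 0 ≤ (ph2 a A B η + c) * (v0 - ξ) := mul_nonneg (by linarith) (by linarith)
  have h6 : (ph1 a A B ξ + c * (ξ - v0)) * (v0 - v) ≤ ph1 a A B v0 * (v0 - v) := by
    apply mul_le_mul_of_nonneg_right _ (by linarith)
    rw [k3] at h5
    linarith
  rw [h3] at h6
  linarith

/-- numerical facts about `√3` -/
lemma sqrt3_bounds : (1.73205 : ℝ) < √3 ∧ √3 < 1.73206 ∧ √3 * √3 = 3 := by
  refine ⟨?_, ?_, Real.mul_self_sqrt (by norm_num)⟩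
  · apply Real.lt_sqrt_of_sq_lt; norm_num
  · rw [Real.sqrt_lt' (by norm_num)]; norm_num

lemma exp_numeric : exp (-(12 / 5)) ≤ 1 / 11 ∧ exp (-(43 / 10)) ≤ 0.0136 ∧ exp (-1.73) ≤ 0.18
    ∧ exp 0.46412 ≤ 5 / 3 := by
  have he := Real.exp_one_gt_d9
  have he2 := Real.exp_one_lt_d9
  refine ⟨?_, ?_, ?_, ?_⟩
  · rw [Real.exp_neg, inv_eq_one_div]
    apply one_div_le_one_div_of_le (by norm_num)
    apply le_of_pow_le_pow_left₀ (n := 5) (by norm_num) (exp_pos _).le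
    rw [← Real.exp_nat_mul]
    have : exp ((5 : ℕ) * (12 / 5)) = exp 1 ^ 12 := by rw [← Real.exp_nat_mul]; norm_num
    rw [this]
    calc (11 : ℝ) ^ 5 ≤ 2.718 ^ 12 := by norm_num
      _ ≤ _ := by gcongr; linarith
  · apply le_of_pow_le_pow_left₀ (n := 10) (by norm_num) (by norm_num)
    rw [← Real.exp_nat_mul]
    have : exp ((10 : ℕ) * (-(43 / 10))) = (exp 1 ^ 43)⁻¹ := by
      rw [← Real.exp_nat_mul, ← Real.exp_neg]; norm_num
    rw [this]
    calc (exp 1 ^ 43)⁻¹ ≤ (2.7182 ^ 43)⁻¹ := by gcongr; linarith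
      _ ≤ _ := by norm_num
  · apply le_of_pow_le_pow_left₀ (n := 100) (by norm_num) (by norm_num)
    rw [← Real.exp_nat_mul]
    have : exp ((100 : ℕ) * (-1.73)) = (exp 1 ^ 173)⁻¹ := by
      rw [← Real.exp_nat_mul, ← Real.exp_neg]; norm_num
    rw [this]
    calc (exp 1 ^ 173)⁻¹ ≤ (2.7182 ^ 173)⁻¹ := by gcongr; linarith
      _ ≤ _ := by norm_num
  · have h1 : exp 0.46412 ≤ exp (1 / 2) := by apply Real.exp_le_exp.mpr; norm_num
    refine le_trans h1 ?_
    apply le_of_pow_le_pow_left₀ (n := 2) (by norm_num) (by norm_num)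
    rw [← Real.exp_nat_mul]
    have : exp ((2 : ℕ) * (1 / 2)) = exp 1 := by norm_num
    rw [this]
    linarith

lemma pow_bound1 (k : ℕ) (hk : 3 ≤ k) : (1 / 11 : ℝ) ^ k ≤ 0.00225 * 0.7 ^ k := by
  induction k, hk using Nat.le_induction with
  | base => norm_num
  | succ k hk ih =>
    rw [pow_succ, pow_succ]
    have : (0 : ℝ) < 0.7 ^ k := by positivity
    nlinarith

lemma pow_bound2 (k : ℕ) (hk : 2 ≤ k) : (k : ℝ) ^ 2 * 0.0136 ^ k ≤ 0.003 * 0.5 ^ k := by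
  induction k, hk using Nat.le_induction with
  | base => norm_num
  | succ k hk ih =>
    rw [pow_succ 0.0136, pow_succ 0.5]
    have h0 : (0 : ℝ) < 0.5 ^ k := by positivity
    have h1 : (0 : ℝ) < 0.0136 ^ k := by positivity
    have hk' : (2 : ℝ) ≤ k := by exact_mod_cast hk
    have h2 : ((k + 1 : ℕ) : ℝ) ^ 2 ≤ 9 / 4 * (k : ℝ) ^ 2 := by push_cast; nlinarith
    calc ((k + 1 : ℕ) : ℝ) ^ 2 * (0.0136 ^ k * 0.0136) ≤ 9 / 4 * (k : ℝ) ^ 2 * (0.0136 ^ k * 0.0136) := by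
          gcongr
      _ = (k : ℝ) ^ 2 * 0.0136 ^ k * (9 / 4 * 0.0136) := by ring
      _ ≤ 0.003 * 0.5 ^ k * (9 / 4 * 0.0136) := by gcongr
      _ ≤ _ := by nlinarith

lemma inv_ge_of_le {u : ℝ} (hu : 0 < u) (hu2 : u ≤ 2 / √3) : √3 / 2 ≤ 1 / u := by
  have h := one_div_le_one_div_of_le hu hu2
  rwa [one_div_div] at h

lemma ph2_rest {a u A B D : ℝ} (ha : 3 ≤ a) (hu : 0 < u) (hB : 0 ≤ B)
    (hE : 2 / √3 ≤ A * u + B / u) (hD : B * exp (-(3 * (A * u + B / u) - 1 / u)) ≤ D) :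
    -(a * exp (-a * (2 / √3)) * (90 * D)) ≤ ph2 a A B u := by
  obtain ⟨s1, s2, s3⟩ := sqrt3_bounds
  set v0 := 2 / √3 with hv0
  have hv0' : v0 ≤ 1.15471 := by
    rw [hv0, div_le_iff₀ (by linarith)]; nlinarith
  set E := A * u + B / u with hEdef
  set w := 1 / u with hw
  have hw0 : 0 < w := by positivity
  have h1 : w / 3 ≤ exp (w / 3 - 1) := by
    have := Real.add_one_le_exp (w / 3 - 1); linarith
  have h2 : w ^ 3 ≤ 27 * exp (w - 3) := by
    have : (w / 3) ^ 3 ≤ exp (w / 3 - 1) ^ 3 := by gcongr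
    rw [← Real.exp_nat_mul] at this
    have e : ((3 : ℕ) : ℝ) * (w / 3 - 1) = w - 3 := by push_cast; ring
    rw [e] at this
    nlinarith
  have h3 : exp (-a * E) ≤ exp (-a * v0) * exp (-3 * (E - v0)) := by
    rw [← Real.exp_add]; apply Real.exp_le_exp.mpr; nlinarith
  have h4 : exp (3 * v0 - 3) ≤ 5 / 3 := by
    refine le_trans (Real.exp_le_exp.mpr ?_) exp_numeric.2.2.2
    have : v0 = 2 * √3 / 3 := by rw [hv0]; field_simp; nlinarith
    rw [this]; norm_num; linarith
  have hph : ph a A B u = exp (-a * E) := rfl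
  have h5 : -(2 * a * B * w ^ 3 * exp (-a * E)) ≤ ph2 a A B u := by
    unfold ph2
    rw [hph]
    have : 2 * a * B / u ^ 3 = 2 * a * B * w ^ 3 := by rw [hw]; field_simp
    rw [this]
    have : 0 ≤ a ^ 2 * (A - B / u ^ 2) ^ 2 * exp (-a * E) := by positivity
    linarith
  refine le_trans ?_ h5
  rw [neg_le_neg_iff]
  have hp := exp_pos (-a * v0)
  calc 2 * a * B * w ^ 3 * exp (-a * E)
      ≤ 2 * a * B * (27 * exp (w - 3)) * (exp (-a * v0) * exp (-3 * (E - v0))) := by gcongr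
    _ = a * exp (-a * v0) * (54 * B * (exp (w - 3) * exp (-3 * (E - v0)))) := by ring
    _ = a * exp (-a * v0) * (54 * exp (3 * v0 - 3) * (B * exp (-(3 * E - w)))) := by
        rw [← Real.exp_add, show w - 3 + -3 * (E - v0) = (3 * v0 - 3) + -(3 * E - w) by ring, Real.exp_add]
        ring
    _ ≤ a * exp (-a * v0) * (54 * (5 / 3) * D) := by
        have : 0 ≤ B * exp (-(3 * E - w)) := by positivity
        gcongr
    _ = _ := by ring

lemma D1_bound {u : ℝ} (hu : 0 < u) (l : ℕ) (hl : 3 ≤ l) :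
    1 * exp (-(3 * ((l : ℝ) ^ 2 / 4 * u + 1 / u) - 1 / u)) ≤ 0.00225 * 0.7 ^ l := by
  refine le_trans ?_ (pow_bound1 l hl)
  rw [one_mul]
  have h : exp (-(3 * ((l : ℝ) ^ 2 / 4 * u + 1 / u) - 1 / u)) ≤ exp (-(12 / 5)) ^ l := by
    rw [← Real.exp_nat_mul]
    apply Real.exp_le_exp.mpr
    have : 3 * ((l : ℝ) ^ 2 / 4 * u + 1 / u) - 1 / u - l * (12 / 5)
        = (3 / 4 * (l * u) ^ 2 - 12 / 5 * (l * u) + 2) / u := by field_simp; ring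
    have h2 : 0 ≤ (3 / 4 * (l * u) ^ 2 - 12 / 5 * (l * u) + 2) / u := by
      apply div_nonneg _ hu.le
      nlinarith [sq_nonneg ((l : ℝ) * u - 8 / 5)]
    linarith
  refine le_trans h ?_
  gcongr
  exact exp_numeric.1

lemma D2_bound {u : ℝ} (hu : 0 < u) (hu2 : u ≤ 2 / √3) (k l : ℕ) (hk : 2 ≤ k) :
    (k : ℝ) ^ 2 * exp (-(3 * ((l : ℝ) ^ 2 / 4 * u + (k : ℝ) ^ 2 / u) - 1 / u))
      ≤ 0.003 * 0.5 ^ k * 0.18 ^ l := by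
  obtain ⟨s1, s2, s3⟩ := sqrt3_bounds
  have hw := inv_ge_of_le hu hu2
  have hk' : (2 : ℝ) ≤ k := by exact_mod_cast hk
  have hk2 : 2 * (k : ℝ) ≤ (k : ℝ) ^ 2 := by nlinarith
  have h : exp (-(3 * ((l : ℝ) ^ 2 / 4 * u + (k : ℝ) ^ 2 / u) - 1 / u))
      ≤ exp (-(43 / 10)) ^ k * exp (-1.73) ^ l := by
    rw [← Real.exp_nat_mul, ← Real.exp_nat_mul, ← Real.exp_add]
    apply Real.exp_le_exp.mpr
    have e : 3 * ((l : ℝ) ^ 2 / 4 * u + (k : ℝ) ^ 2 / u) - 1 / u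
        = (3 / 4 * (l * u) ^ 2 - 1.73 * (l * u) + 1) / u + 1.73 * l + (3 * (k : ℝ) ^ 2 - 2) * (1 / u) := by
      field_simp; ring
    have h2 : 0 ≤ (3 / 4 * (l * u) ^ 2 - 1.73 * (l * u) + 1) / u := by
      apply div_nonneg _ hu.le
      nlinarith [sq_nonneg ((l : ℝ) * u - 173 / 150)]
    have h3 : (3 * (k : ℝ) ^ 2 - 2) * (√3 / 2) ≤ (3 * (k : ℝ) ^ 2 - 2) * (1 / u) :=
      mul_le_mul_of_nonneg_left hw (by nlinarith)
    have h4 : (3 * (k : ℝ) ^ 2 - 2) * 0.866 ≤ (3 * (k : ℝ) ^ 2 - 2) * (√3 / 2) :=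
      mul_le_mul_of_nonneg_left (by linarith) (by nlinarith)
    rw [e]
    nlinarith
  calc _ ≤ (k : ℝ) ^ 2 * (exp (-(43 / 10)) ^ k * exp (-1.73) ^ l) := by gcongr
    _ ≤ (k : ℝ) ^ 2 * (0.0136 ^ k * 0.18 ^ l) := by
        gcongr
        · exact exp_numeric.2.1
        · exact exp_numeric.2.2.1
    _ = (k : ℝ) ^ 2 * 0.0136 ^ k * 0.18 ^ l := by ring
    _ ≤ _ := by
        exact mul_le_mul_of_nonneg_right (pow_bound2 k hk) (by positivity)

lemma ph2_zero_one {a u : ℝ} (ha : 3 ≤ a) (hu2 : u ≤ 2 / √3) :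
    a * exp (-a * (2 / √3)) * 3 ≤ ph2 a 1 0 u := by
  unfold ph2 ph
  have h : exp (-a * (2 / √3)) ≤ exp (-a * (1 * u + 0 / u)) := by
    apply Real.exp_le_exp.mpr
    rw [zero_div]; nlinarith
  have hp := exp_pos (-a * (2 / √3))
  simp only [zero_div, sub_zero, mul_zero]
  rw [zero_div] at h
  calc a * exp (-a * (2 / √3)) * 3 ≤ a * exp (-a * (2 / √3)) * a := by gcongr
    _ = a ^ 2 * exp (-a * (2 / √3)) := by ring
    _ ≤ a ^ 2 * exp (-a * (1 * u + 0)) := by gcongr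
    _ = _ := by ring

lemma ph2_one_one {a u : ℝ} (ha : 3 ≤ a) (hu : 0 < u) (hu2 : u ≤ 2 / √3) :
    -(a * exp (-a * (2 / √3)) * 0.6) ≤ ph2 a (1 / 4) 1 u := by
  obtain ⟨s1, s2, s3⟩ := sqrt3_bounds
  have hw := inv_ge_of_le hu hu2
  set w := 1 / u with hwdef
  have h1 : -0.6 ≤ a * (1 / 4 - 1 / u ^ 2) ^ 2 - 2 / u ^ 3 := by
    have e1 : 1 / u ^ 2 = w ^ 2 := by rw [hwdef]; field_simp
    have e2 : 2 / u ^ 3 = 2 * w ^ 3 := by rw [hwdef]; field_simp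
    rw [e1, e2]
    have h2 : 3 * (1 / 4 - w ^ 2) ^ 2 ≤ a * (1 / 4 - w ^ 2) ^ 2 := by gcongr
    have hw' : 0.866 ≤ w := by linarith
    have h3 : -0.6 ≤ 3 * (1 / 4 - w ^ 2) ^ 2 - 2 * w ^ 3 := by
      obtain ⟨d, hd⟩ : ∃ d, w = 0.866 + d := ⟨w - 0.866, by ring⟩
      have hd0 : 0 ≤ d := by linarith
      rw [hd]
      have : 0 ≤ d ^ 2 := by positivity
      have : 0 ≤ d ^ 3 := by positivity
      have : 0 ≤ d ^ 4 := by positivity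
      ring_nf
      nlinarith
    linarith
  have h4 : exp (-a * (1 / 4 * u + 1 / u)) ≤ exp (-a * (2 / √3)) := by
    apply Real.exp_le_exp.mpr
    have : 2 / √3 ≤ 1 / 4 * u + 1 / u := by
      have e : 1 / 4 * u + 1 / u - 2 / √3 = (2 / √3 - u) * (√3 / 2 - u / 4) / u := by
        field_simp
        ring_nf
        have : √3 ^ 2 = 3 := by rw [sq, s3]
        try rw [this]
        try ring
      have hu3 : 2 / √3 ≤ 1.2 := by rw [div_le_iff₀ (by linarith)]; linarith
      have : 0 ≤ (2 / √3 - u) * (√3 / 2 - u / 4) / u := by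
        apply div_nonneg _ hu.le
        apply mul_nonneg <;> linarith
      linarith
    nlinarith
  have hp := exp_pos (-a * (1 / 4 * u + 1 / u))
  unfold ph2 ph
  have e : (a ^ 2 * (1 / 4 - 1 / u ^ 2) ^ 2 - 2 * a * 1 / u ^ 3) * exp (-a * (1 / 4 * u + 1 / u))
    = a * ((a * (1 / 4 - 1 / u ^ 2) ^ 2 - 2 / u ^ 3) * exp (-a * (1 / 4 * u + 1 / u))) := by ring
  rw [e]
  have h5 : -0.6 * exp (-a * (1 / 4 * u + 1 / u)) ≤
    (a * (1 / 4 - 1 / u ^ 2) ^ 2 - 2 / u ^ 3) * exp (-a * (1 / 4 * u + 1 / u)) := by gcongr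
  have h6 : a * (-0.6 * exp (-a * (2 / √3))) ≤
    a * ((a * (1 / 4 - 1 / u ^ 2) ^ 2 - 2 / u ^ 3) * exp (-a * (1 / 4 * u + 1 / u))) :=
    mul_le_mul_of_nonneg_left (by linarith) (by linarith)
  linarith

noncomputable def DD (q : ℤ × ℤ) : ℝ :=
  0.003 * (0.5 ^ q.1.natAbs * 0.18 ^ q.2.natAbs)
    + 0.00225 * ((if q.1 = 1 ∨ q.1 = -1 then (1 : ℝ) else 0) * 0.7 ^ q.2.natAbs)

lemma DD_nonneg (q : ℤ × ℤ) : 0 ≤ DD q := by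
  unfold DD
  split_ifs <;> positivity

lemma hasSum_pm_one : HasSum (fun n : ℤ => if n = 1 ∨ n = -1 then (1 : ℝ) else 0) 2 := by
  have : HasSum (fun n : ℤ => if n = 1 ∨ n = -1 then (1 : ℝ) else 0)
      (∑ n ∈ ({1, -1} : Finset ℤ), if n = 1 ∨ n = -1 then (1 : ℝ) else 0) :=
    hasSum_sum_of_ne_finset_zero (by intro n hn; simp at hn; simp [hn])
  rw [Finset.sum_pair (by norm_num)] at this
  norm_num at this
  convert this using 1

lemma hs_mul {f g : ℤ → ℝ} {s t : ℝ} (hf : HasSum f s) (hg : HasSum g t) (nf : ∀ n, 0 ≤ f n)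
    (ng : ∀ n, 0 ≤ g n) : HasSum (fun q : ℤ × ℤ => f q.1 * g q.2) (s * t) := by
  have h : Summable (fun q : ℤ × ℤ => f q.1 * g q.2) := hf.summable.mul_of_nonneg hg.summable nf ng
  have e := hf.summable.tsum_mul_tsum hg.summable h
  rw [hf.tsum_eq, hg.tsum_eq] at e
  rw [e]
  exact h.hasSum

lemma hasSum_DD_gen {r1 r2 r3 c d : ℝ} (h1 : 0 ≤ r1) (h1' : r1 < 1) (h2 : 0 ≤ r2) (h2' : r2 < 1)
    (h3 : 0 ≤ r3) (h3' : r3 < 1) :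
    HasSum (fun q : ℤ × ℤ => c * (r1 ^ q.1.natAbs * r2 ^ q.2.natAbs)
    + d * ((if q.1 = 1 ∨ q.1 = -1 then (1 : ℝ) else 0) * r3 ^ q.2.natAbs))
    (c * ((1 + r1) / (1 - r1) * ((1 + r2) / (1 - r2))) + d * (2 * ((1 + r3) / (1 - r3)))) := by
  have s1 := hasSum_geom_int h1 h1'
  have s2 := hasSum_geom_int h2 h2'
  have s3 := hasSum_geom_int h3 h3'
  have n1 : ∀ n : ℤ, 0 ≤ r1 ^ n.natAbs := fun n => pow_nonneg h1 _
  have n2 : ∀ n : ℤ, 0 ≤ r2 ^ n.natAbs := fun n => pow_nonneg h2 _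
  have n3 : ∀ n : ℤ, 0 ≤ r3 ^ n.natAbs := fun n => pow_nonneg h3 _
  have k1 : HasSum (fun q : ℤ × ℤ => r1 ^ q.1.natAbs * r2 ^ q.2.natAbs)
      ((1 + r1) / (1 - r1) * ((1 + r2) / (1 - r2))) :=
    by have h := hs_mul s1 s2 n1 n2; exact h
  have k2 : HasSum (fun q : ℤ × ℤ => (if q.1 = 1 ∨ q.1 = -1 then (1 : ℝ) else 0) * r3 ^ q.2.natAbs)
      (2 * ((1 + r3) / (1 - r3))) := by
    have s4 := hasSum_pm_one
    generalize hf : (fun n : ℤ => if n = 1 ∨ n = -1 then (1 : ℝ) else 0) = f at s4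
    have n4 : ∀ n : ℤ, 0 ≤ f n := by
      intro n; rw [← hf]; dsimp only; split_ifs <;> norm_num
    have hm : HasSum (fun q : ℤ × ℤ => f q.1 * r3 ^ q.2.natAbs) (2 * ((1 + r3) / (1 - r3))) :=
      by have h := hs_mul s4 s3 n4 n3; exact h
    rw [← hf] at hm
    exact hm
  exact (k1.mul_left c).add (k2.mul_left d)

lemma hasSum_DD : HasSum DD (0.003 * ((1 + 0.5) / (1 - 0.5) * ((1 + 0.18) / (1 - 0.18)))
    + 0.00225 * (2 * ((1 + 0.7) / (1 - 0.7)))) := by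
  unfold DD
  exact hasSum_DD_gen (by norm_num) (by norm_num) (by norm_num) (by norm_num) (by norm_num)
    (by norm_num)

def shearMap (p : ℤ × ℤ) : ℤ × ℤ := (p.1, 2 * p.2 + p.1)

lemma shear_inj : Function.Injective shearMap := by
  rintro ⟨a, b⟩ ⟨c, d⟩ h
  simp only [shearMap, Prod.mk.injEq] at h ⊢
  omega

lemma DD_shear : Summable (fun p => DD (shearMap p)) ∧ ∑' p, DD (shearMap p) < 0.0386 := by
  have hs := hasSum_DD.summable
  have h1 : Summable (fun p => DD (shearMap p)) := hs.comp_injective shear_inj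
  refine ⟨h1, ?_⟩
  have h2 := tsum_comp_le_tsum_of_inj hs DD_nonneg shear_inj
  have h3 : ∑' p, DD (shearMap p) ≤ ∑' q, DD q := h2
  rw [hasSum_DD.tsum_eq] at h3
  refine lt_of_le_of_lt h3 ?_
  norm_num

noncomputable def gam (p : ℤ × ℤ) : ℝ :=
  -3 * (if p ∈ ({(0, 1), (0, -1)} : Finset (ℤ × ℤ)) then 1 else 0)
  + 0.6 * (if p ∈ ({(1, 0), (1, -1), (-1, 0), (-1, 1)} : Finset (ℤ × ℤ)) then 1 else 0)
  + 90 * DD (shearMap p)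

lemma hasSum_ind (S : Finset (ℤ × ℤ)) :
    HasSum (fun p => if p ∈ S then (1 : ℝ) else 0) (S.card : ℝ) := by
  have : HasSum (fun p => if p ∈ S then (1 : ℝ) else 0) (∑ p ∈ S, if p ∈ S then (1 : ℝ) else 0) :=
    hasSum_sum_of_ne_finset_zero (by intro n hn; simp [hn])
  convert this using 1
  rw [Finset.sum_ite_mem]; simp

lemma gam_sum : Summable gam ∧ ∑' p, gam p < 0 := by
  obtain ⟨h1, h2⟩ := DD_shear
  have k := (((hasSum_ind {(0, 1), (0, -1)}).mul_left (-3)).add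
    ((hasSum_ind {(1, 0), (1, -1), (-1, 0), (-1, 1)}).mul_left 0.6)).add (h1.hasSum.mul_left 90)
  have k' : HasSum gam _ := k
  refine ⟨k'.summable, ?_⟩
  rw [k'.tsum_eq]
  have c1 : ({(0, 1), (0, -1)} : Finset (ℤ × ℤ)).card = 2 := by decide
  have c2 : ({(1, 0), (1, -1), (-1, 0), (-1, 1)} : Finset (ℤ × ℤ)).card = 4 := by decide
  rw [c1, c2]
  norm_num at h2 ⊢
  linarith

noncomputable def cA (p : ℤ × ℤ) : ℝ := ((p.2 : ℝ) + p.1 * (1 / 2)) ^ 2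
noncomputable def cB (p : ℤ × ℤ) : ℝ := (p.1 : ℝ) ^ 2

lemma natAbs_cast_sq (n : ℤ) : (n.natAbs : ℝ) ^ 2 = (n : ℝ) ^ 2 := by
  have := congrArg (fun z : ℤ => (z : ℝ)) (Int.natAbs_sq n)
  push_cast at this
  rw [← this]; simp

lemma ph2_gam {a u : ℝ} (ha : 3 ≤ a) (hu : 0 < u) (hu2 : u ≤ 2 / √3) (p : ℤ × ℤ) :
    -(a * exp (-a * (2 / √3)) * gam p) ≤ ph2 a (cA p) (cB p) u := by
  obtain ⟨s1, s2, s3⟩ := sqrt3_bounds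
  obtain ⟨n, m⟩ := p
  have hDD := DD_nonneg (shearMap (n, m))
  have hpos : 0 < a * exp (-a * (2 / √3)) := by have := exp_pos (-a * (2 / √3)); nlinarith
  have hv0 : 2 / √3 ≤ 1.2 := by rw [div_le_iff₀ (by linarith)]; linarith
  have hw := inv_ge_of_le hu hu2
  have hA : cA (n, m) = ((2 * m + n).natAbs : ℝ) ^ 2 / 4 := by
    rw [natAbs_cast_sq]; unfold cA; push_cast; ring
  have hB : cB (n, m) = (n.natAbs : ℝ) ^ 2 := by
    rw [natAbs_cast_sq]; unfold cB; rfl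
  by_cases hn0 : n = 0
  · subst hn0
    have hB0 : cB (0, m) = 0 := by simp [cB]
    by_cases hm : m = 1 ∨ m = -1
    · have hA1 : cA (0, m) = 1 := by rcases hm with rfl | rfl <;> simp [cA]
      rw [hA1, hB0]
      refine le_trans ?_ (ph2_zero_one ha hu2)
      have hg : gam (0, m) = -3 + 90 * DD (shearMap (0, m)) := by
        unfold gam
        rcases hm with rfl | rfl <;> simp
      rw [hg]
      nlinarith [mul_nonneg hpos.le hDD]
    · have hg : gam (0, m) = 90 * DD (shearMap (0, m)) := by
        unfold gam
        push Not at hm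
        simp [hm.1, hm.2]
      rw [hg, hB0]
      have h1 : 0 ≤ ph2 a (cA (0, m)) 0 u := by
        unfold ph2 ph
        simp only [mul_zero, zero_div, sub_zero]
        positivity
      refine le_trans ?_ h1
      nlinarith [mul_nonneg hpos.le hDD]
  by_cases hn1 : n.natAbs = 1
  · by_cases hM : (2 * m + n).natAbs = 1
    · rw [hA, hB, hn1, hM]
      have hg : gam (n, m) = 0.6 + 90 * DD (shearMap (n, m)) := by
        have : (n, m) = (1, 0) ∨ (n, m) = (1, -1) ∨ (n, m) = (-1, 0) ∨ (n, m) = (-1, 1) := by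
          simp only [Prod.mk.injEq]; omega
        unfold gam
        rcases this with h | h | h | h <;> rw [h] <;> simp
      rw [hg]
      have := ph2_one_one ha hu hu2
      rw [Nat.cast_one, one_pow]
      nlinarith [mul_nonneg hpos.le hDD]
    · have hl : 3 ≤ (2 * m + n).natAbs := by omega
      have hg : gam (n, m) = 90 * DD (shearMap (n, m)) := by
        have h1 : ¬ ((n, m) = (1, 0) ∨ (n, m) = (1, -1) ∨ (n, m) = (-1, 0) ∨ (n, m) = (-1, 1)) := by
          simp only [Prod.mk.injEq]; omega
        unfold gam
        rw [if_neg, if_neg]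
        · ring
        · simpa only [Finset.mem_insert, Finset.mem_singleton] using h1
        · simp [hn0]
      rw [hg]
      refine ph2_rest ha hu (by rw [hB]; positivity) ?_ ?_
      · rw [hA, hB, hn1]
        have hl' : (3 : ℝ) ≤ ((2 * m + n).natAbs : ℝ) := by exact_mod_cast hl
        have h9 : (9 : ℝ) ≤ ((2 * m + n).natAbs : ℝ) ^ 2 := by nlinarith
        have : 2 ≤ u + 1 / u := by
          have e : u + 1 / u - 2 = (u - 1) ^ 2 / u := by field_simp; ring
          have : 0 ≤ (u - 1) ^ 2 / u := by positivity
          linarith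
        rw [Nat.cast_one, one_pow]
        have h8 : 9 * u ≤ ((2 * m + n).natAbs : ℝ) ^ 2 * u := by gcongr
        linarith
      · rw [hA, hB, hn1]
        have := D1_bound hu _ hl
        have e : ((1 : ℕ) : ℝ) ^ 2 = 1 := by norm_num
        rw [e]
        refine le_trans this ?_
        unfold DD shearMap
        have h1 : n = 1 ∨ n = -1 := by omega
        simp only [h1, if_true]
        have : (0 : ℝ) ≤ 0.003 * (0.5 ^ n.natAbs * 0.18 ^ (2 * m + n).natAbs) := by positivity
        linarith
  · have hk : 2 ≤ n.natAbs := by omega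
    have hg : gam (n, m) = 90 * DD (shearMap (n, m)) := by
      have h1 : ¬ ((n, m) = (1, 0) ∨ (n, m) = (1, -1) ∨ (n, m) = (-1, 0) ∨ (n, m) = (-1, 1)) := by
        simp only [Prod.mk.injEq]; omega
      unfold gam
      rw [if_neg, if_neg]
      · ring
      · simpa only [Finset.mem_insert, Finset.mem_singleton] using h1
      · simp [hn0]
    rw [hg]
    refine ph2_rest ha hu (by rw [hB]; positivity) ?_ ?_
    · rw [hA, hB]
      have hk' : (2 : ℝ) ≤ (n.natAbs : ℝ) := by exact_mod_cast hk
      have h4 : (4 : ℝ) ≤ (n.natAbs : ℝ) ^ 2 := by nlinarith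
      have h5 : 0 ≤ ((2 * m + n).natAbs : ℝ) ^ 2 / 4 * u := by positivity
      rw [div_eq_mul_one_div ((n.natAbs : ℝ) ^ 2) u]
      nlinarith
    · rw [hA, hB]
      refine le_trans (D2_bound hu hu2 _ _ hk) ?_
      unfold DD shearMap
      have : (0 : ℝ) ≤ 0.00225 * ((if n = 1 ∨ n = -1 then (1 : ℝ) else 0) * 0.7 ^ (2 * m + n).natAbs) := by
        split_ifs <;> positivity
      simp only
      linarith

/-- Sum of the first derivatives at the hexagonal point vanishes. -/
lemma ph1_sum_zero {a : ℝ} (ha : 0 < a) :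
    Summable (fun p => ph1 a (cA p) (cB p) (2 / √3)) ∧
    ∑' p, ph1 a (cA p) (cB p) (2 / √3) = 0 := by
  obtain ⟨s1, s2, s3⟩ := sqrt3_bounds
  set v0 := 2 / √3 with hv0
  have hv0pos : 0 < v0 := by positivity
  set c := a * v0 with hc
  have hcpos : 0 < c := by positivity
  let q : ℤ × ℤ → ℝ := fun p => (p.2 : ℝ) ^ 2 + p.2 * p.1 + (p.1 : ℝ) ^ 2
  let g : ℤ × ℤ → ℝ := fun p => (p.2 : ℝ) ^ 2 + p.2 * p.1 - (p.1 : ℝ) ^ 2 / 2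
  have hv2 : v0 ^ 2 = 4 / 3 := by
    rw [hv0, div_pow, sq √3, s3]; norm_num
  have hE : ∀ p, ph1 a (cA p) (cB p) v0 = -a * (g p * exp (-c * q p)) := by
    intro p
    unfold ph1 ph
    have e1 : cA p - cB p / v0 ^ 2 = g p := by
      rw [hv2]; simp only [cA, cB, g]; ring
    have e2 : cA p * v0 + cB p / v0 = v0 * q p := by
      have : cB p / v0 = cB p / v0 ^ 2 * v0 := by field_simp
      rw [this, hv2]; simp only [cA, cB, q]; ring
    rw [e1, e2, hc]
    have : -a * (v0 * q p) = -(a * v0) * q p := by ring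
    rw [this]; ring
  have hq : ∀ p, ((p.1 : ℝ) ^ 2 + (p.2 : ℝ) ^ 2) / 2 ≤ q p := by
    intro p
    simp only [q]
    nlinarith [sq_nonneg ((p.1 : ℝ) + p.2)]
  have hgq : ∀ p, |g p| ≤ 3 * q p := by
    intro p
    simp only [q, g]
    rw [abs_le]
    constructor <;> nlinarith [sq_nonneg ((p.1 : ℝ) + p.2), sq_nonneg ((p.1 : ℝ)), sq_nonneg ((p.2 : ℝ))]
  have hS : Summable (fun p => g p * exp (-c * q p)) := by
    have hb := (summable_gauss2 (c := c / 4) (by positivity)).mul_left (6 / c)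
    refine Summable.of_norm_bounded hb fun p => ?_
    rw [norm_mul, Real.norm_of_nonneg (exp_pos _).le, Real.norm_eq_abs]
    have hq0 : 0 ≤ q p := le_trans (by positivity) (hq p)
    have h1 : c / 2 * q p ≤ exp (c / 2 * q p) := by
      have := Real.add_one_le_exp (c / 2 * q p); linarith
    have h2 : 3 * q p ≤ 6 / c * exp (c / 2 * q p) := by
      have : 6 / c * (c / 2 * q p) ≤ 6 / c * exp (c / 2 * q p) := by gcongr
      have e : 6 / c * (c / 2 * q p) = 3 * q p := by field_simp; ring
      linarith
    calc |g p| * exp (-c * q p) ≤ (6 / c * exp (c / 2 * q p)) * exp (-c * q p) := by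
          gcongr; exact (hgq p).trans h2
      _ = 6 / c * exp (-(c / 2 * q p)) := by
          rw [mul_assoc, ← Real.exp_add]; congr 2; ring
      _ ≤ _ := by
          gcongr
          have := hq p
          nlinarith
  -- the rotation of order three
  let ρ : ℤ × ℤ ≃ ℤ × ℤ :=
    { toFun := fun p => (p.2 + p.1, -p.1)
      invFun := fun p => (-p.2, p.1 + p.2)
      left_inv := by rintro ⟨x, y⟩; simp
      right_inv := by rintro ⟨x, y⟩; simp }
  have hqρ : ∀ p, q (ρ p) = q p := by
    intro p
    simp only [q, ρ, Equiv.coe_fn_mk]; push_cast; ring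
  have hg3 : ∀ p, g p + g (ρ p) + g (ρ (ρ p)) = 0 := by
    intro p
    simp only [g, ρ, Equiv.coe_fn_mk]; push_cast; ring
  have hS1 : Summable (fun p => g (ρ p) * exp (-c * q p)) := by
    have := ρ.summable_iff.mpr hS
    refine this.congr fun p => ?_
    simp only [Function.comp, hqρ]
  have hS2 : Summable (fun p => g (ρ (ρ p)) * exp (-c * q p)) := by
    have := ρ.summable_iff.mpr hS1
    refine this.congr fun p => ?_
    simp only [Function.comp, hqρ]
  have hT1 : ∑' p, g (ρ p) * exp (-c * q p) = ∑' p, g p * exp (-c * q p) := by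
    rw [← ρ.tsum_eq (fun p => g p * exp (-c * q p))]
    simp only [hqρ]
  have hT2 : ∑' p, g (ρ (ρ p)) * exp (-c * q p) = ∑' p, g p * exp (-c * q p) := by
    rw [← hT1, ← ρ.tsum_eq (fun p => g (ρ p) * exp (-c * q p))]
    simp only [hqρ]
  have hT : ∑' p, g p * exp (-c * q p) = 0 := by
    have h := (hS.add hS1).tsum_add hS2
    rw [hS.tsum_add hS1, hT1, hT2] at h
    have h0 : ∑' p, (g p * exp (-c * q p) + g (ρ p) * exp (-c * q p) + g (ρ (ρ p)) * exp (-c * q p)) = 0 := by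
      rw [← tsum_zero (α := ℝ) (β := ℤ × ℤ)]
      refine tsum_congr fun p => ?_
      rw [← add_mul, ← add_mul, hg3, zero_mul]
    rw [h0] at h
    linarith
  constructor
  · simp_rw [hE]
    exact hS.mul_left _
  · simp_rw [hE]
    rw [tsum_mul_left, hT, mul_zero]

/-- Monotonicity step in `y`. -/
lemma TT_step_y {α y : ℝ} (hα : 1 ≤ α) (hy : √3 / 2 < y) :
    TT α (1 / 2) (√3 / 2) < TT α (1 / 2) y := by
  obtain ⟨s1, s2, s3⟩ := sqrt3_bounds
  have hy0 : 0 < y := by linarith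
  set a := π * α with ha_def
  have ha : 3 ≤ a := by nlinarith [pi_gt_three]
  have hTT : ∀ y : ℝ, 0 < y → TT α (1 / 2) y = ∑' p, ph a (cA p) (cB p) (1 / y) ∧
      Summable (fun p => ph a (cA p) (cB p) (1 / y)) := by
    intro y hy
    have e : ∀ p : ℤ × ℤ, exp (-a * (((p.2 : ℝ) + p.1 * (1 / 2)) ^ 2 / y + (p.1 : ℝ) ^ 2 * y))
        = ph a (cA p) (cB p) (1 / y) := by
      intro p
      unfold ph cA cB
      congr 2
      field_simp
    constructor
    · unfold TT
      refine tsum_congr fun p => ?_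
      rw [← e]
      congr 1
      rw [ha_def]; ring
    · exact (summable_form (a := a) (x := 1 / 2) (by linarith) hy).congr e
  obtain ⟨t1, u1⟩ := hTT y hy0
  obtain ⟨t2, u2⟩ := hTT (√3 / 2) (by positivity)
  rw [one_div_div] at t2 u2
  rw [t1, t2]
  set v := 1 / y with hv
  set v0 := 2 / √3 with hv0
  have hvpos : 0 < v := by positivity
  have hvv : v < v0 := by
    have := one_div_lt_one_div_of_lt (by positivity : 0 < √3 / 2) hy
    rwa [one_div_div] at this
  obtain ⟨w1, w2⟩ := ph1_sum_zero (a := a) (by linarith)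
  obtain ⟨g1, g2⟩ := gam_sum
  set K := a * exp (-a * v0) with hK
  have hKpos : 0 < K := by have := exp_pos (-a * v0); nlinarith
  have hle : ∀ p, ph a (cA p) (cB p) v0 + ph1 a (cA p) (cB p) v0 * (v - v0)
      - gam p * (K / 2 * (v - v0) ^ 2) ≤ ph a (cA p) (cB p) v := by
    intro p
    have := ph_taylor (a := a) (A := cA p) (B := cB p) (c := K * gam p) hvpos hvv
      (fun u hu hu2 => ph2_gam ha hu hu2 p)
    linarith
  have hsum : Summable (fun p => ph a (cA p) (cB p) v0 + ph1 a (cA p) (cB p) v0 * (v - v0)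
      - gam p * (K / 2 * (v - v0) ^ 2)) :=
    (u2.add (w1.mul_right _)).sub (g1.mul_right _)
  have h1 := Summable.tsum_le_tsum hle hsum u1
  rw [(u2.add (w1.mul_right _)).tsum_sub (g1.mul_right _), u2.tsum_add (w1.mul_right _),
    tsum_mul_right, tsum_mul_right, w2, zero_mul, add_zero] at h1
  have h2 : 0 < K / 2 * (v - v0) ^ 2 := by
    have : v - v0 ≠ 0 := by linarith
    positivity
  nlinarith

end montAux

section glue
open Real

lemma TT_neg_x (α x y : ℝ) : TT α (-x) y = TT α x y := by
  unfold TT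
  rw [← (Equiv.prodCongr (Equiv.neg ℤ) (Equiv.refl ℤ)).tsum_eq]
  refine tsum_congr fun p => ?_
  simp

/-- Minimality among reduced points. -/
lemma TT_min {α x y : ℝ} (hα : 0 < α) (hy : 0 < y) (hy2 : 3 ≤ 4 * y ^ 2) (hx : |x| ≤ 1 / 2) :
    TT α (1 / 2) (√3 / 2) ≤ TT α x y ∧
    (TT α x y = TT α (1 / 2) (√3 / 2) → |x| = 1 / 2 ∧ y = √3 / 2) := by
  obtain ⟨s1, s2, s3⟩ := sqrt3_bounds
  have hy3 : √3 / 2 ≤ y := by nlinarith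
  have habs : ∀ α : ℝ, TT α |x| y = TT α x y := by
    intro α
    rcases abs_choice x with h | h <;> rw [h]
    exact TT_neg_x _ _ _
  have key : ∀ α : ℝ, 1 ≤ α → TT α (1 / 2) (√3 / 2) ≤ TT α x y ∧
    (TT α x y = TT α (1 / 2) (√3 / 2) → |x| = 1 / 2 ∧ y = √3 / 2) := by
    intro α hα
    rw [← habs α]
    have h1 : TT α (1 / 2) y ≤ TT α |x| y ∧ (TT α |x| y = TT α (1 / 2) y → |x| = 1 / 2) := by
      rcases hx.eq_or_lt with h | h
      · rw [h]; exact ⟨le_rfl, fun _ => rfl⟩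
      · have := TT_step_x hα hy hy2 (abs_nonneg x) h
        exact ⟨this.le, fun h' => absurd h' this.ne'⟩
    have h2 : TT α (1 / 2) (√3 / 2) ≤ TT α (1 / 2) y ∧
        (TT α (1 / 2) y = TT α (1 / 2) (√3 / 2) → y = √3 / 2) := by
      rcases hy3.eq_or_lt with h | h
      · rw [← h]; exact ⟨le_rfl, fun _ => rfl⟩
      · have := TT_step_y hα h
        exact ⟨this.le, fun h' => absurd h' this.ne'⟩
    refine ⟨h2.1.trans h1.1, fun h => ⟨h1.2 ?_, h2.2 ?_⟩⟩
    · linarith [h1.1, h2.1]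
    · linarith [h1.1, h2.1]
  rcases le_total 1 α with h | h
  · exact key α h
  · have h1 : 1 ≤ 1 / α := by rw [le_div_iff₀ hα]; linarith
    obtain ⟨k1, k2⟩ := key (1 / α) h1
    rw [TT_functional hα hy, TT_functional hα (by positivity)] at k1 k2
    exact ⟨le_of_mul_le_mul_left k1 hα, fun h => k2 (by rw [h])⟩

lemma act_mul (A B : Matrix (Fin 2) (Fin 2) ℝ) (v : EuclideanSpace ℝ (Fin 2)) :
    act (A * B) v = act A (act B v) := by
  unfold act
  simp only [Equiv.apply_symm_apply, Matrix.mulVec_mulVec]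

lemma act_apply_zero (A : Matrix (Fin 2) (Fin 2) ℝ) (v : EuclideanSpace ℝ (Fin 2)) :
    act A v 0 = A 0 0 * v 0 + A 0 1 * v 1 := by
  simp [act]

lemma act_apply_one (A : Matrix (Fin 2) (Fin 2) ℝ) (v : EuclideanSpace ℝ (Fin 2)) :
    act A v 1 = A 1 0 * v 0 + A 1 1 * v 1 := by
  simp [act]

/-- Parametrization of the lattice. -/
def emb (A : Matrix (Fin 2) (Fin 2) ℝ) (p : ℤ × ℤ) : EuclideanSpace ℝ (Fin 2) :=
  act A !₂[(p.2 : ℝ), (p.1 : ℝ)]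

lemma emb_norm (A : Matrix (Fin 2) (Fin 2) ℝ) (p : ℤ × ℤ) :
    ‖emb A p‖ ^ 2 = (A 0 0 * p.2 + A 0 1 * p.1) ^ 2 + (A 1 0 * p.2 + A 1 1 * p.1) ^ 2 := by
  rw [EuclideanSpace.norm_sq_eq, Fin.sum_univ_two]
  unfold emb
  rw [act_apply_zero, act_apply_one]
  simp

lemma range_emb (A : Matrix (Fin 2) (Fin 2) ℝ) : Set.range (emb A) = act A '' intLat := by
  ext v
  constructor
  · rintro ⟨p, rfl⟩
    exact ⟨_, ⟨p.2, p.1, by simp, by simp⟩, rfl⟩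
  · rintro ⟨w, ⟨a, b, h0, h1⟩, rfl⟩
    refine ⟨(b, a), ?_⟩
    unfold emb
    congr 1
    ext i
    fin_cases i
    · simp [h0]
    · simp [h1]

lemma emb_injective {A : Matrix (Fin 2) (Fin 2) ℝ} (hA : A.det = 1) :
    Function.Injective (emb A) := by
  rintro ⟨n, m⟩ ⟨n', m'⟩ h
  rw [Matrix.det_fin_two] at hA
  have h0 := congrArg (fun v => v 0) h
  have h1 := congrArg (fun v => v 1) h
  simp only [emb, act_apply_zero, act_apply_one] at h0 h1
  simp at h0 h1
  have e1 : (n : ℝ) = n' := by linear_combination A 0 0 * h1 - A 1 0 * h0 - (n - n') * hA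
  have e2 : (m : ℝ) = m' := by linear_combination A 1 1 * h0 - A 0 1 * h1 - (m - m') * hA
  rw [Prod.mk.injEq]
  exact ⟨by exact_mod_cast e1, by exact_mod_cast e2⟩

def gG (A : Matrix (Fin 2) (Fin 2) ℝ) : ℝ := A 0 0 ^ 2 + A 1 0 ^ 2
def gH (A : Matrix (Fin 2) (Fin 2) ℝ) : ℝ := A 0 0 * A 0 1 + A 1 0 * A 1 1

lemma gG_pos {A : Matrix (Fin 2) (Fin 2) ℝ} (hA : A.det = 1) : 0 < gG A := by
  rw [Matrix.det_fin_two] at hA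
  unfold gG
  by_contra h
  have h0 : A 0 0 = 0 := by nlinarith [sq_nonneg (A 0 0), sq_nonneg (A 1 0)]
  have h1 : A 1 0 = 0 := by nlinarith [sq_nonneg (A 0 0), sq_nonneg (A 1 0)]
  rw [h0, h1] at hA
  norm_num at hA

lemma FTheta_eq {A : Matrix (Fin 2) (Fin 2) ℝ} (hA : A.det = 1) {t : ℝ} (ht : 0 < t) :
    FTheta t (act A '' intLat) = TT (t / π) (gH A / gG A) (1 / gG A) - 1 := by
  have hG := gG_pos hA
  have hterm : ∀ p : ℤ × ℤ, -t * ‖emb A p‖ ^ 2 =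
      -t * (((p.2 : ℝ) + p.1 * (gH A / gG A)) ^ 2 / (1 / gG A) + (p.1 : ℝ) ^ 2 * (1 / gG A)) := by
    intro p
    rw [emb_norm]
    have e : gH A ^ 2 + 1 = gG A * (A 0 1 ^ 2 + A 1 1 ^ 2) := by
      rw [Matrix.det_fin_two] at hA
      unfold gH gG
      linear_combination (-(A 0 0 * A 1 1 - A 0 1 * A 1 0) - 1) * hA
    congr 1
    have e2 : ((p.2 : ℝ) + p.1 * (gH A / gG A)) ^ 2 / (1 / gG A) + (p.1 : ℝ) ^ 2 * (1 / gG A)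
        = gG A * (p.2 : ℝ) ^ 2 + 2 * p.1 * p.2 * gH A + (p.1 : ℝ) ^ 2 * ((gH A ^ 2 + 1) / gG A) := by
      field_simp; ring
    rw [e2, e, mul_div_cancel_left₀ _ hG.ne']
    unfold gH gG
    ring
  have hs : Summable (fun p : ℤ × ℤ => exp (-t * ‖emb A p‖ ^ 2)) := by
    simp_rw [hterm]
    exact summable_form ht (by positivity)
  have hT : TT (t / π) (gH A / gG A) (1 / gG A) = ∑' p : ℤ × ℤ, exp (-t * ‖emb A p‖ ^ 2) := by
    unfold TT
    refine tsum_congr fun p => ?_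
    rw [hterm]
    congr 1
    have : -π * (t / π) = -t := by field_simp
    rw [this]
  have he0 : emb A 0 = 0 := by
    ext i
    fin_cases i
    · simp [emb, act_apply_zero]
    · simp [emb, act_apply_one]
  have hset : (act A '' intLat) \ {0} = emb A '' ({0} : Set (ℤ × ℤ))ᶜ := by
    rw [← range_emb]
    ext v
    constructor
    · rintro ⟨⟨p, rfl⟩, h⟩
      refine ⟨p, ?_, rfl⟩
      rintro rfl
      exact h he0
    · rintro ⟨p, h, rfl⟩
      refine ⟨⟨p, rfl⟩, ?_⟩
      intro h2
      apply h
      apply emb_injective hA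
      rw [he0]; exact h2
  have h1 : FTheta t (act A '' intLat) =
      ∑' p : (({0} : Set (ℤ × ℤ))ᶜ : Set (ℤ × ℤ)), exp (-t * ‖emb A p‖ ^ 2) := by
    unfold FTheta
    rw [hset]
    exact tsum_image (fun v : EuclideanSpace ℝ (Fin 2) => exp (-t * ‖v‖ ^ 2))
      ((emb_injective hA).injOn)
  have h2 := hs.tsum_subtype_add_tsum_subtype_compl ({0} : Set (ℤ × ℤ))
  rw [hT, h1, ← h2, tsum_singleton (0 : ℤ × ℤ) (fun p => exp (-t * ‖emb A p‖ ^ 2)), he0]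
  simp

lemma int_act (p q r s : ℤ) (h : p * s - q * r = 1) :
    act !![(p : ℝ), q; r, s] '' intLat = intLat := by
  have hR : (p : ℝ) * s - q * r = 1 := by exact_mod_cast h
  ext v
  constructor
  · rintro ⟨w, ⟨a, b, h0, h1⟩, rfl⟩
    refine ⟨p * a + q * b, r * a + s * b, ?_, ?_⟩
    · rw [act_apply_zero, h0, h1]; simp
    · rw [act_apply_one, h0, h1]; simp
  · rintro ⟨a, b, h0, h1⟩
    refine ⟨!₂[((s * a - q * b : ℤ) : ℝ), ((-r * a + p * b : ℤ) : ℝ)], ⟨s * a - q * b, -r * a + p * b, rfl, rfl⟩, ?_⟩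
    ext i
    fin_cases i
    · simp [act_apply_zero, h0]
      linear_combination (a : ℝ) * hR
    · simp [act_apply_one, h1]
      linear_combination (b : ℝ) * hR

lemma act_int_image (A : Matrix (Fin 2) (Fin 2) ℝ) (p q r s : ℤ) (h : p * s - q * r = 1) :
    act (A * !![(p : ℝ), q; r, s]) '' intLat = act A '' intLat := by
  conv_rhs => rw [← int_act p q r s h, Set.image_image]
  simp_rw [← act_mul]

open scoped Modular in
lemma reduce {A : Matrix (Fin 2) (Fin 2) ℝ} (hA : A.det = 1) :
    ∃ Ar : Matrix (Fin 2) (Fin 2) ℝ, Ar.det = 1 ∧ act Ar '' intLat = act A '' intLat ∧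
      |gH Ar / gG Ar| ≤ 1 / 2 ∧ 3 ≤ 4 * (1 / gG Ar) ^ 2 := by
  have hG := gG_pos hA
  let f1 : ℂ := ⟨A 0 0, A 1 0⟩
  let f2 : ℂ := ⟨A 0 1, A 1 1⟩
  have hf1 : f1 ≠ 0 := by
    intro h
    have h0 : A 0 0 = 0 := congrArg Complex.re h
    have h1 : A 1 0 = 0 := congrArg Complex.im h
    rw [Matrix.det_fin_two, h0, h1] at hA
    norm_num at hA
  have him : 0 < (f2 / f1).im := by
    rw [Complex.div_im]
    simp only [f1, f2, Complex.normSq_mk]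
    rw [← sub_div]
    rw [Matrix.det_fin_two] at hA
    unfold gG at hG
    apply div_pos _ (by nlinarith)
    nlinarith
  let z : UpperHalfPlane := ⟨f2 / f1, him⟩
  obtain ⟨g, hg⟩ := ModularGroup.exists_smul_mem_fd z
  have hy := ModularGroup.three_le_four_mul_im_sq_of_mem_fd hg
  have hx := hg.2
  have hdet : g 0 0 * g 1 1 - g 0 1 * g 1 0 = 1 := by
    have := g.det_coe
    rwa [Matrix.det_fin_two] at this
  set p := g 0 0 with hp
  set q := g 0 1 with hq
  set r := g 1 0 with hr
  set s := g 1 1 with hs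
  have hdet' : s * p - q * r = 1 := by linarith
  have hdR : (s : ℝ) * p - q * r = 1 := by exact_mod_cast hdet'
  refine ⟨A * !![(s : ℝ), q; r, p], ?_, act_int_image A s q r p hdet', ?_⟩
  · rw [Matrix.det_mul, hA, Matrix.det_fin_two_of, one_mul]
    exact hdR
  set Ar := A * !![(s : ℝ), q; r, p] with hAr
  have hArdet : Ar.det = 1 := by
    rw [hAr, Matrix.det_mul, hA, Matrix.det_fin_two_of, one_mul]
    exact hdR
  have hG' := gG_pos hArdet
  have e00 : Ar 0 0 = A 0 0 * s + A 0 1 * r := by simp [hAr, Matrix.mul_apply, Fin.sum_univ_two]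
  have e01 : Ar 0 1 = A 0 0 * q + A 0 1 * p := by simp [hAr, Matrix.mul_apply, Fin.sum_univ_two]
  have e10 : Ar 1 0 = A 1 0 * s + A 1 1 * r := by simp [hAr, Matrix.mul_apply, Fin.sum_univ_two]
  have e11 : Ar 1 1 = A 1 0 * q + A 1 1 * p := by simp [hAr, Matrix.mul_apply, Fin.sum_univ_two]
  have hgz : ((g • z : UpperHalfPlane) : ℂ) = (⟨Ar 0 1, Ar 1 1⟩ : ℂ) / ⟨Ar 0 0, Ar 1 0⟩ := by
    rw [UpperHalfPlane.coe_specialLinearGroup_apply]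
    have hz : (z : ℂ) = f2 / f1 := rfl
    have n1 : (⟨Ar 0 1, Ar 1 1⟩ : ℂ) = f1 * (p * (f2 / f1) + q) := by
      rw [mul_add, mul_left_comm, mul_div_cancel₀ _ hf1]
      apply Complex.ext
      · simp [f1, f2, e01]; ring
      · simp [f1, f2, e11]; ring
    have n2 : (⟨Ar 0 0, Ar 1 0⟩ : ℂ) = f1 * (r * (f2 / f1) + s) := by
      rw [mul_add, mul_left_comm, mul_div_cancel₀ _ hf1]
      apply Complex.ext
      · simp [f1, f2, e00]; ring
      · simp [f1, f2, e10]; ring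
    rw [n1, n2, mul_div_mul_left _ _ hf1, hz]
    simp [hp, hq, hr, hs]
  have hre : (g • z).re = gH Ar / gG Ar := by
    have : (g • z).re = ((g • z : UpperHalfPlane) : ℂ).re := rfl
    rw [this, hgz, Complex.div_re]
    simp only [Complex.normSq_mk]
    rw [← add_div]
    unfold gH gG
    congr 1 <;> ring
  have him' : (g • z).im = 1 / gG Ar := by
    have : (g • z).im = ((g • z : UpperHalfPlane) : ℂ).im := rfl
    rw [this, hgz, Complex.div_im]
    simp only [Complex.normSq_mk]
    rw [← sub_div]
    unfold gG
    rw [Matrix.det_fin_two] at hArdet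
    congr 1
    · linarith
    · ring
  rw [hre] at hx
  rw [him'] at hy
  exact ⟨hx, hy⟩

/-- The basis matrix of the triangular lattice. -/
def triMat : Matrix (Fin 2) (Fin 2) ℝ :=
  !![√(2 / √3), √(2 / √3) / 2; 0, √(2 / √3) * √3 / 2]

lemma triLat_eq : triLat = act triMat '' intLat := by
  ext v
  constructor
  · rintro ⟨a, b, h0, h1⟩
    refine ⟨!₂[(a : ℝ), b], ⟨a, b, by simp, by simp⟩, ?_⟩
    ext i
    fin_cases i
    · simp [act_apply_zero, triMat, h0]; ring
    · simp [act_apply_one, triMat, h1]; ring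
  · rintro ⟨w, ⟨a, b, h0, h1⟩, rfl⟩
    refine ⟨a, b, ?_, ?_⟩
    · rw [act_apply_zero, h0, h1]; simp [triMat]; ring
    · rw [act_apply_one, h0, h1]; simp [triMat]; ring

lemma tri_sq : √(2 / √3) * √(2 / √3) = 2 / √3 := Real.mul_self_sqrt (by positivity)

lemma tri_det : triMat.det = 1 := by
  obtain ⟨s1, s2, s3⟩ := sqrt3_bounds
  rw [triMat, Matrix.det_fin_two_of]
  have : √(2 / √3) * (√(2 / √3) * √3 / 2) = √(2 / √3) * √(2 / √3) * √3 / 2 := by ring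
  rw [this, tri_sq]
  field_simp
  try norm_num

lemma tri_G : gG triMat = 2 / √3 := by
  have := tri_sq
  have e : gG triMat = √(2 / √3) * √(2 / √3) := by
    unfold gG triMat
    simp only [Matrix.of_apply, Matrix.cons_val_zero, Matrix.cons_val_one]
    ring
  rw [e, this]

lemma tri_H : gH triMat = 1 / √3 := by
  simp [gH, triMat]
  have : √2 / √√3 * (√2 / √√3 / 2) = (√(2 / √3) * √(2 / √3)) / 2 := by
    rw [Real.sqrt_div (by norm_num)]; ring
  rw [this, tri_sq]; field_simp

lemma gram_eq (A : Matrix (Fin 2) (Fin 2) ℝ) (hA : A.det = 1) :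
    A.transpose * A = !![gG A, gH A; gH A, (gH A ^ 2 + 1) / gG A] := by
  have hG := gG_pos hA
  have e : gH A ^ 2 + 1 = gG A * (A 0 1 ^ 2 + A 1 1 ^ 2) := by
    rw [Matrix.det_fin_two] at hA
    unfold gH gG
    linear_combination (-(A 0 0 * A 1 1 - A 0 1 * A 1 0) - 1) * hA
  rw [e, mul_div_cancel_left₀ _ hG.ne']
  ext i j
  fin_cases i <;> fin_cases j <;> simp [Matrix.mul_apply, Fin.sum_univ_two, gG, gH] <;> ring

lemma exists_rot {A : Matrix (Fin 2) (Fin 2) ℝ} (hA : A.det = 1) (hG : gG A = gG triMat)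
    (hH : gH A = gH triMat) :
    ∃ R : Matrix (Fin 2) (Fin 2) ℝ, IsRotation R ∧ act A '' intLat = act R '' triLat := by
  have hu : IsUnit triMat.det := by rw [tri_det]; exact isUnit_one
  have g1 : A.transpose * A = triMat.transpose * triMat := by
    rw [gram_eq A hA, gram_eq triMat tri_det, hG, hH]
  have hRT : A * triMat⁻¹ * triMat = A := by
    rw [Matrix.mul_assoc, Matrix.nonsing_inv_mul _ hu, Matrix.mul_one]
  refine ⟨A * triMat⁻¹, ⟨?_, ?_⟩, ?_⟩
  · have := congrArg Matrix.det hRT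
    rw [Matrix.det_mul, tri_det, mul_one, hA] at this
    exact this
  · rw [mul_eq_one_comm]
    calc (A * triMat⁻¹).transpose * (A * triMat⁻¹)
        = triMat⁻¹.transpose * (A.transpose * A) * triMat⁻¹ := by
          rw [Matrix.transpose_mul]; simp only [Matrix.mul_assoc]
      _ = (triMat * triMat⁻¹).transpose * (triMat * triMat⁻¹) := by
          rw [g1, Matrix.transpose_mul]; simp only [Matrix.mul_assoc]
      _ = 1 := by rw [Matrix.mul_nonsing_inv _ hu]; simp
  · rw [triLat_eq, Set.image_image]
    simp_rw [← act_mul]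
    rw [hRT]

lemma rot_theta {R : Matrix (Fin 2) (Fin 2) ℝ} (hR : IsRotation R) {t : ℝ} (ht : 0 < t) :
    FTheta t (act R '' triLat) = FTheta t triLat := by
  have e : act R '' triLat = act (R * triMat) '' intLat := by
    rw [triLat_eq, Set.image_image]
    simp_rw [← act_mul]
  have hd : (R * triMat).det = 1 := by rw [Matrix.det_mul, hR.1, tri_det, one_mul]
  have hR2 : R.transpose * R = 1 := mul_eq_one_comm.mp hR.2
  have g1 : (R * triMat).transpose * (R * triMat) = triMat.transpose * triMat := by
    rw [Matrix.transpose_mul, Matrix.mul_assoc, ← Matrix.mul_assoc R.transpose, hR2, Matrix.one_mul]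
  rw [gram_eq _ hd, gram_eq _ tri_det] at g1
  have h1 : gG (R * triMat) = gG triMat := by
    have := congrFun (congrFun g1 0) 0
    simpa using this
  have h2 : gH (R * triMat) = gH triMat := by
    have := congrFun (congrFun g1 0) 1
    simpa using this
  rw [e, triLat_eq, FTheta_eq hd ht, FTheta_eq tri_det ht, h1, h2]

lemma montgomery_aux (t : ℝ) (ht : 0 < t) (A : Matrix (Fin 2) (Fin 2) ℝ) (hA : A.det = 1) :
    FTheta t triLat ≤ FTheta t (act A '' intLat) ∧
    (FTheta t (act A '' intLat) = FTheta t triLat ↔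
      ∃ R : Matrix (Fin 2) (Fin 2) ℝ, IsRotation R ∧ act A '' intLat = act R '' triLat) := by
  obtain ⟨s1, s2, s3⟩ := sqrt3_bounds
  obtain ⟨B, hB, hBA, hx, hy⟩ := reduce hA
  have hG := gG_pos hB
  have htri : FTheta t triLat = TT (t / π) (1 / 2) (√3 / 2) - 1 := by
    rw [triLat_eq, FTheta_eq tri_det ht, tri_G, tri_H, one_div_div]
    congr 2
    field_simp
  obtain ⟨m1, m2⟩ := TT_min (α := t / π) (by positivity) (by positivity) hy hx
  have hFB := FTheta_eq hB ht
  refine ⟨?_, ?_, ?_⟩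
  · rw [← hBA, hFB, htri]; linarith
  · intro h
    rw [← hBA, hFB, htri] at h
    obtain ⟨k1, k2⟩ := m2 (by linarith)
    rw [← hBA]
    have hGB : gG B = gG triMat := by
      rw [tri_G, ← one_div_one_div (gG B), k2, one_div_div]
    rcases abs_choice (gH B / gG B) with h3 | h3
    · rw [h3] at k1
      refine exists_rot hB hGB ?_
      rw [div_eq_iff hG.ne'] at k1
      rw [k1, hGB, tri_G, tri_H]; field_simp
    · rw [h3, neg_eq_iff_eq_neg, div_eq_iff hG.ne'] at k1
      have hC := act_int_image B 1 1 0 1 (by norm_num)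
      rw [← hC]
      set C := B * !![((1 : ℤ) : ℝ), ((1 : ℤ) : ℝ); ((0 : ℤ) : ℝ), ((1 : ℤ) : ℝ)] with hCdef
      have e00 : C 0 0 = B 0 0 := by simp [hCdef, Matrix.mul_apply, Fin.sum_univ_two]
      have e01 : C 0 1 = B 0 0 + B 0 1 := by simp [hCdef, Matrix.mul_apply, Fin.sum_univ_two]
      have e10 : C 1 0 = B 1 0 := by simp [hCdef, Matrix.mul_apply, Fin.sum_univ_two]
      have e11 : C 1 1 = B 1 0 + B 1 1 := by simp [hCdef, Matrix.mul_apply, Fin.sum_univ_two]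
      refine exists_rot ?_ ?_ ?_
      · rw [hCdef, Matrix.det_mul, hB, Matrix.det_fin_two_of]; norm_num
      · rw [← hGB]; unfold gG; rw [e00, e10]
      · have : gH C = gG B + gH B := by unfold gH gG; rw [e00, e01, e10, e11]; ring
        rw [this, k1, hGB, tri_G, tri_H]; field_simp; norm_num
  · rintro ⟨R, hR, h⟩
    rw [h, rot_theta hR ht]

end glue

/-- Montgomery's theorem: among unimodular lattices `L = A(ℤ²)`, the theta-like
sum `F_t(L)` is minimized exactly at the equilateral triangular lattice, up to
rotation. -/
theorem montgomery
    (t : ℝ) (ht : 0 < t)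
    (A : Matrix (Fin 2) (Fin 2) ℝ) (hA : A.det = 1) :
    FTheta t triLat ≤ FTheta t (act A '' intLat) ∧
    (FTheta t (act A '' intLat) = FTheta t triLat ↔
      ∃ R : Matrix (Fin 2) (Fin 2) ℝ, IsRotation R ∧ act A '' intLat = act R '' triLat) := by
  exact montgomery_aux t ht A hA
end
end
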